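/- arXiv:1109.4914 — 2 statements merged into one kernel-verified Lean document; each statement's English description precedes it below -/
import Mathlib

section
/- Let ℍ be a finite quotient of the Kagome lattice tiled by k = v(ℍ)/36 large hexagonal tiles. Then there is a homotopy equivalence I(ℍ) ≃ ( ⋁_{2^k} S^{8k-1} ) ∨ X for some space X; that is, the independence complex of ℍ splits off a wedge of 2^{v(ℍ)/36} spheres of dimension 2·v(ℍ)/9 − 1. -/
attribute [local instance] Classical.propDecidable

noncomputable section

open Finset Module
open scoped DirectSum

universe u

/-- An abstract simplicial complex on vertex type `V`, encoded by its set of faces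
(finite subsets of `V`), required to be downward closed and to contain the empty face.
(The complex with only the empty face is the "empty complex", i.e. `S^{-1}`.) -/
structure SComplex (V : Type u) where
  faces : Set (Finset V)
  empty_mem : ∅ ∈ faces
  down_closed : ∀ {s t : Finset V}, s ∈ faces → t ⊆ s → t ∈ faces

namespace SComplex

variable {V : Type u}

/-- Ordered `j`-simplices of `K`: tuples of `j` vertices (repetitions allowed) spanning a
face of `K`.  Chains on these compute the reduced homology of `K` (this is the augmented,
unnormalized chain complex of the simplicial set associated to `K`); the level `j`
corresponds to reduced degree `j - 1`. -/
def OSimplex (K : SComplex V) (j : ℕ) : Type u :=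
  {t : Fin j → V // Finset.univ.image t ∈ K.faces}

/-- The `ℚ`-vector space of (level `j`, i.e. reduced degree `j-1`) simplicial chains. -/
abbrev Chain (K : SComplex V) (j : ℕ) : Type u := OSimplex K j →₀ ℚ

/-- The basis chain corresponding to a single ordered simplex. -/
def ofSimplex (K : SComplex V) (j : ℕ) (s : OSimplex K j) : Chain K j :=
  Finsupp.single s 1

/-- Boundary of a single ordered simplex: the alternating sum of its facets. -/
def bdryO (K : SComplex V) (j : ℕ) (s : OSimplex K (j + 1)) : Chain K j :=
  ∑ i : Fin (j + 1), Finsupp.single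
    ⟨s.1 ∘ i.succAbove, K.down_closed s.2 (by
      intro v hv
      simp only [Finset.mem_image] at hv ⊢
      obtain ⟨w, -, rfl⟩ := hv
      exact ⟨i.succAbove w, Finset.mem_univ _, rfl⟩)⟩
    ((-1 : ℚ) ^ (i : ℕ))

/-- The simplicial boundary map (from level `j+1` to level `j`). -/
def bdry (K : SComplex V) (j : ℕ) : Chain K (j + 1) →ₗ[ℚ] Chain K j :=
  Finsupp.lsum ℚ fun s => LinearMap.toSpanSingleton ℚ (Chain K j) (bdryO K j s)

/-- Cycles at level `j` (reduced degree `j - 1`).  At level `0` (spanned by the empty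
simplex) every chain is a cycle: this is the augmented complex. -/
def cyclesAt (K : SComplex V) : (j : ℕ) → Submodule ℚ (Chain K j)
  | 0 => ⊤
  | j + 1 => LinearMap.ker (bdry K j)

/-- Boundaries at level `j`. -/
def boundariesAt (K : SComplex V) (j : ℕ) : Submodule ℚ (Chain K j) :=
  LinearMap.range (bdry K j)

/-- Reduced simplicial homology with rational coefficients:
`homologyAt K j` is the reduced homology group `H̃_{j-1}(K; ℚ)`
(so `homologyAt K 0 = H̃_{-1}`, `homologyAt K (i+1) = H̃_i`). -/
abbrev homologyAt (K : SComplex V) (j : ℕ) : Type u :=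
  cyclesAt K j ⧸ ((boundariesAt K j).comap (cyclesAt K j).subtype)

/-- The homology class of a cycle. -/
def hClass (K : SComplex V) (j : ℕ) (z : Chain K j) (hz : z ∈ cyclesAt K j) :
    homologyAt K j :=
  Submodule.Quotient.mk ⟨z, hz⟩

/-- The reduced Betti number `β̃_{j-1}(K) = dim_ℚ H̃_{j-1}(K; ℚ)`. -/
def bettiAt (K : SComplex V) (j : ℕ) : ℕ := finrank ℚ (homologyAt K j)

/-- The total reduced Betti number `β̃(K) = ∑_i β̃_i(K)` (including degree `-1`). -/
def totalBetti (K : SComplex V) : ℕ := finrank ℚ (⨁ j : ℕ, homologyAt K j)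

/-- Simplicial cochains with rational coefficients. -/
abbrev Cochain (K : SComplex V) (j : ℕ) : Type u := Chain K j →ₗ[ℚ] ℚ

/-- The simplicial coboundary map, the transpose of the boundary. -/
def cobdry (K : SComplex V) (j : ℕ) : Cochain K j →ₗ[ℚ] Cochain K (j + 1) :=
  (bdry K j).dualMap

/-- Cocycles at level `j` (reduced degree `j-1`). -/
def cocyclesAt (K : SComplex V) (j : ℕ) : Submodule ℚ (Cochain K j) :=
  LinearMap.ker (cobdry K j)

/-- Coboundaries at level `j`. -/
def cobordsAt (K : SComplex V) : (j : ℕ) → Submodule ℚ (Cochain K j)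
  | 0 => ⊥
  | j + 1 => LinearMap.range (cobdry K j)

/-- Reduced simplicial cohomology with rational coefficients:
`cohomologyAt K j` is `H̃^{j-1}(K; ℚ)`. -/
abbrev cohomologyAt (K : SComplex V) (j : ℕ) : Type u :=
  cocyclesAt K j ⧸ ((cobordsAt K j).comap (cocyclesAt K j).subtype)

/-- The cohomology class of a cocycle. -/
def hcClass (K : SComplex V) (j : ℕ) (γ : Cochain K j) (hγ : γ ∈ cocyclesAt K j) :
    cohomologyAt K j :=
  Submodule.Quotient.mk ⟨γ, hγ⟩

/-- Evaluation of a cocycle on homology classes. -/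
def pairingAux (K : SComplex V) (j : ℕ) (γ : cocyclesAt K j) :
    homologyAt K j →ₗ[ℚ] ℚ :=
  Submodule.liftQ _ ((γ : Cochain K j).comp (cyclesAt K j).subtype) (by
    rintro ⟨z, hz⟩ hmem
    simp only [Submodule.mem_comap, Submodule.subtype_apply] at hmem
    obtain ⟨x, hx⟩ := hmem
    simp only [LinearMap.mem_ker, LinearMap.comp_apply, Submodule.subtype_apply]
    have hker : cobdry K j (γ : Cochain K j) = 0 := γ.2
    have h2 : (cobdry K j (γ : Cochain K j)) x = 0 := by rw [hker]; rfl
    calc (γ : Cochain K j) z = (γ : Cochain K j) (bdry K j x) := by rw [hx]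
      _ = (cobdry K j (γ : Cochain K j)) x := rfl
      _ = 0 := h2)

/-- The evaluation pairing `⟨·,·⟩ : H̃^{j-1}(K;ℚ) ⊗ H̃_{j-1}(K;ℚ) → ℚ`
given by evaluating cochains on chains. -/
def pairing (K : SComplex V) (j : ℕ) :
    cohomologyAt K j →ₗ[ℚ] homologyAt K j →ₗ[ℚ] ℚ :=
  Submodule.liftQ _
    { toFun := fun γ => pairingAux K j γ
      map_add' := by
        intro γ δ
        apply LinearMap.ext
        intro x
        obtain ⟨⟨z, hz⟩, rfl⟩ := Submodule.Quotient.mk_surjective _ x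
        simp [pairingAux, Submodule.liftQ_apply]
      map_smul' := by
        intro c γ
        apply LinearMap.ext
        intro x
        obtain ⟨⟨z, hz⟩, rfl⟩ := Submodule.Quotient.mk_surjective _ x
        simp [pairingAux, Submodule.liftQ_apply] }
    (by
      rintro ⟨γ, hγ⟩ hmem
      simp only [Submodule.mem_comap, Submodule.subtype_apply] at hmem
      simp only [LinearMap.mem_ker]
      apply LinearMap.ext
      intro x
      obtain ⟨⟨z, hz⟩, rfl⟩ := Submodule.Quotient.mk_surjective _ x
      simp only [LinearMap.coe_mk, AddHom.coe_mk, LinearMap.zero_apply]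
      cases j with
      | zero =>
          have : γ = 0 := by simpa [cobordsAt] using hmem
          simp [pairingAux, Submodule.liftQ_apply, this]
      | succ j =>
          obtain ⟨η, hη⟩ := hmem
          have hz0 : bdry K j z = 0 := hz
          simp only [pairingAux, Submodule.liftQ_apply]
          calc γ.comp (cyclesAt K (j+1)).subtype ⟨z, hz⟩ = γ z := rfl
            _ = (cobdry K j η) z := by rw [hη]
            _ = η (bdry K j z) := rfl
            _ = 0 := by rw [hz0]; exact map_zero η)

end SComplex
section Graphs

open SComplex

variable {V : Type u}

/-- The independence complex `I(G)` of a graph `G`: faces are the independent sets. -/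
def indepComplex (G : SimpleGraph V) : SComplex V where
  faces := {s : Finset V | ∀ v ∈ s, ∀ w ∈ s, ¬ G.Adj v w}
  empty_mem := by simp
  down_closed := by
    intro s t hs hts v hv w hw
    exact hs v (hts hv) w (hts hw)

/-- `s` is an independent set of the graph `G`. -/
def IsIndepSet (G : SimpleGraph V) (s : Finset V) : Prop :=
  ∀ v ∈ s, ∀ w ∈ s, ¬ G.Adj v w

/-- `σ` is a dominating set of `G`: every vertex is in the closed neighbourhood `N[σ]`. -/
def IsDominating (G : SimpleGraph V) (σ : Finset V) : Prop :=
  ∀ v : V, ∃ w ∈ σ, w = v ∨ G.Adj w v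

/-- The closed neighbourhood `N[σ]` of a finite set of vertices. -/
def closedNbhd (G : SimpleGraph V) (σ : Finset V) : Set V :=
  {v | ∃ w ∈ σ, w = v ∨ G.Adj w v}

/-- An induced matching of size `k` in `G`: `k` edges `(fst i, snd i)` such that
any two vertices belonging to distinct edges are distinct and non-adjacent. -/
structure InducedMatching (G : SimpleGraph V) (k : ℕ) where
  fst : Fin k → V
  snd : Fin k → V
  adj : ∀ i, G.Adj (fst i) (snd i)
  disjoint : ∀ i j, i ≠ j → fst i ≠ fst j ∧ fst i ≠ snd j ∧ snd i ≠ fst j ∧ snd i ≠ snd j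
  induced : ∀ i j, i ≠ j → ¬ G.Adj (fst i) (fst j) ∧ ¬ G.Adj (fst i) (snd j) ∧
    ¬ G.Adj (snd i) (fst j) ∧ ¬ G.Adj (snd i) (snd j)

namespace InducedMatching

variable {G : SimpleGraph V} {k : ℕ}

/-- The set of vertices covered by the matching. -/
def vertexFinset (M : InducedMatching G k) : Finset V :=
  Finset.univ.image M.fst ∪ Finset.univ.image M.snd

/-- A transversal of a matching: a set of vertices of the matching containing exactly one
vertex from each edge. -/
def IsTransversal (M : InducedMatching G k) (σ : Finset V) : Prop :=
  σ ⊆ M.vertexFinset ∧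
    ∀ i, (M.fst i ∈ σ ∧ M.snd i ∉ σ) ∨ (M.snd i ∈ σ ∧ M.fst i ∉ σ)

/-- The chain `([v_1] - [w_1]) ∧ ⋯ ∧ ([v_k] - [w_k])` representing the image `α_M` of the
fundamental class of the sphere `I(M) = S^{k-1}` in `I(G)`. -/
def matchingChain (M : InducedMatching G k) : Chain (indepComplex G) k :=
  ∑ c : Fin k → Bool,
    ((-1 : ℚ) ^ (Finset.univ.filter (fun i => c i = true)).card) •
      Finsupp.single
        ⟨fun i => if c i then M.snd i else M.fst i, by
          intro v hv w hw
          simp only [Finset.mem_image, Finset.mem_univ, true_and] at hv hw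
          obtain ⟨i, rfl⟩ := hv
          obtain ⟨j, rfl⟩ := hw
          by_cases hij : i = j
          · subst hij
            by_cases h : c i <;> simp [h, SimpleGraph.irrefl]
          · obtain ⟨h1, h2, h3, h4⟩ := M.induced i j hij
            by_cases hi : c i <;> by_cases hj : c j <;> simp [hi, hj, h1, h2, h3, h4]⟩
        1

end InducedMatching

namespace SComplex

/-- The coefficient of the cochain `σ^∨` on an ordered simplex: `±1` (the sign of the
corresponding permutation) on the orderings of `σ` and `0` on all other simplices. -/
def dualCoeff (K : SComplex V) (k : ℕ) (σ : Finset V) (s : OSimplex K k) : ℚ :=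
  if h : Function.Injective s.1 ∧ Finset.univ.image s.1 = σ then
    have hcard : Fintype.card {x // x ∈ σ} = k := by
      rw [Fintype.card_coe, ← h.2, Finset.card_image_of_injective _ h.1]
      simp
    ((Equiv.Perm.sign
      ((Equiv.ofBijective
          (fun i : Fin k => (⟨s.1 i, by
            rw [← h.2]; exact Finset.mem_image_of_mem _ (Finset.mem_univ i)⟩ : {x // x ∈ σ}))
          (by
            rw [Fintype.bijective_iff_injective_and_card]
            exact ⟨fun a b hab => h.1 (congrArg Subtype.val hab), by simp [hcard]⟩)).trans
        (Fintype.equivFinOfCardEq hcard)) : ℤ) : ℚ)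
  else 0

/-- The cochain `σ^∨` associated to an independent set `σ` of cardinality `k`: it assigns
`±1` to the two orientations of `σ` and `0` to all other simplices.  When `σ` is a maximal
independent set this cochain is a cocycle. -/
def dualCochain (K : SComplex V) (k : ℕ) (σ : Finset V) : Cochain K k :=
  Finsupp.linearCombination ℚ (dualCoeff K k σ)

end SComplex

end Graphs
section Topology

open SComplex

variable {V : Type u}

/-- The geometric realization of a simplicial complex on a finite vertex set: the space of
convex weightings of the vertices whose support is a face.  (The realization of the empty
complex, which has only the empty face, is the empty space `S^{-1}`.) -/
def realization [Fintype V] (K : SComplex V) : Type u :=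
  {f : V → ℝ // (∀ v, 0 ≤ f v) ∧ (∑ v, f v) = 1 ∧
    Finset.univ.filter (fun v => f v ≠ 0) ∈ K.faces}

instance realizationTopology [Fintype V] (K : SComplex V) :
    TopologicalSpace (realization K) := by
  unfold realization; infer_instance

/-- The induced subcomplex `K[U]` of `K` on a vertex subset `U` (kept on the ambient
vertex type). -/
def inducedSub (K : SComplex V) (U : Set V) : SComplex V where
  faces := {s | s ∈ K.faces ∧ ∀ v ∈ s, v ∈ U}
  empty_mem := ⟨K.empty_mem, by simp⟩
  down_closed := by
    rintro s t ⟨hs, hsU⟩ hts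
    exact ⟨K.down_closed hs hts, fun v hv => hsU v (hts hv)⟩

/-- The continuous inclusion of the realization of a subcomplex. -/
def inclMap [Fintype V] {K L : SComplex V} (h : K.faces ⊆ L.faces) :
    C(realization K, realization L) :=
  ⟨fun p => ⟨p.1, p.2.1, p.2.2.1, h p.2.2.2⟩,
    Continuous.subtype_mk continuous_subtype_val _⟩

/-- The relation generated by gluing in a mapping cone: the base of the cylinder is glued
along `f` and the top of the cylinder is collapsed to a point. -/
inductive coneRel {A X : Type u} (f : A → X) :
    (A × unitInterval) ⊕ X → (A × unitInterval) ⊕ X → Prop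
  | base (a : A) : coneRel f (Sum.inl (a, 0)) (Sum.inr (f a))
  | tip (a b : A) : coneRel f (Sum.inl (a, 1)) (Sum.inl (b, 1))

/-- The mapping cone (homotopy cofibre) `C(f)` of a continuous map `f : A → X`. -/
def MappingCone {A X : Type u} [TopologicalSpace A] [TopologicalSpace X]
    (f : C(A, X)) : Type u :=
  Quot (coneRel f.toFun)

instance mappingConeTopology {A X : Type u} [TopologicalSpace A] [TopologicalSpace X]
    (f : C(A, X)) : TopologicalSpace (MappingCone f) := by
  unfold MappingCone; infer_instance

/-- The wedge sum `X ∨ Y` of two pointed spaces. -/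
def Wedge2 (X Y : Type u) [TopologicalSpace X] [TopologicalSpace Y]
    (x0 : X) (y0 : Y) : Type u :=
  Quot (fun p q : X ⊕ Y => p = Sum.inl x0 ∧ q = Sum.inr y0)

instance wedge2Topology (X Y : Type u) [TopologicalSpace X] [TopologicalSpace Y]
    (x0 : X) (y0 : Y) : TopologicalSpace (Wedge2 X Y x0 y0) := by
  unfold Wedge2; infer_instance

/-- The wedge sum `⋁_i X_i` of a family of pointed spaces. -/
def PtdWedge {ι : Type u} (X : ι → Type u) [∀ i, TopologicalSpace (X i)]
    (pt : ∀ i, X i) : Type u :=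
  Quot (fun p q : (Σ i, X i) => (∃ i, p = ⟨i, pt i⟩) ∧ (∃ j, q = ⟨j, pt j⟩))

instance ptdWedgeTopology {ι : Type u} (X : ι → Type u) [∀ i, TopologicalSpace (X i)]
    (pt : ∀ i, X i) : TopologicalSpace (PtdWedge X pt) := by
  unfold PtdWedge; infer_instance

/-- The relation generating the unreduced suspension (as the join with `S^0`, so that the
suspension of the empty space is `S^0`): the two cone points are the two extra points. -/
inductive suspRel (X : Type u) : (X × unitInterval) ⊕ Bool → (X × unitInterval) ⊕ Bool → Prop
  | bot (x : X) : suspRel X (Sum.inl (x, 0)) (Sum.inr false)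
  | top (x : X) : suspRel X (Sum.inl (x, 1)) (Sum.inr true)

/-- Unreduced suspension `Σ X` (with the join convention `Σ ∅ = S^0`). -/
def Susp (X : Type u) : Type u := Quot (suspRel X)

instance suspTopology (X : Type u) [TopologicalSpace X] : TopologicalSpace (Susp X) := by
  unfold Susp; infer_instance

/-- Iterated suspension `Σ^n X`. -/
def IterSusp : ℕ → Type u → Type u
  | 0, X => X
  | n + 1, X => Susp (IterSusp n X)

instance iterSuspTopology : ∀ (n : ℕ) (X : Type u) [TopologicalSpace X],
    TopologicalSpace (IterSusp n X)
  | 0, _, i => i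
  | n + 1, X, i => @suspTopology _ (@iterSuspTopology n X i)

/-- The quotient space `X / A` obtained by collapsing a subset `A` to a point. -/
def QuotBy (X : Type u) [TopologicalSpace X] (A : Set X) : Type u :=
  Quot (fun p q : X => p ∈ A ∧ q ∈ A)

instance quotByTopology (X : Type u) [TopologicalSpace X] (A : Set X) :
    TopologicalSpace (QuotBy X A) := by
  unfold QuotBy; infer_instance

end Topology
section Kagome

/-- `i'` is the cyclic successor of `i` in `Fin N`. -/
def finSucc {N : ℕ} (i i' : Fin N) : Prop := (i' : ℕ) = ((i : ℕ) + 1) % N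

/-- Generating relation for the Kagome (hexagonal dimer) lattice with periodic boundary
conditions: cells are indexed by `Fin n × Fin q` (a cell is a `(2,0) × (0,2√3)` box) and
each cell contains six vertices, labelled by `Fin 6`:
`0 = (2i, 2j√3)`, `1 = (2i+1, 2j√3)` (a full horizontal row),
`2 = (2i+1/2, 2j√3+√3/2)` (a sparse row),
`3 = (2i, 2j√3+√3)`, `4 = (2i+1, 2j√3+√3)` (the next full row),
`5 = (2i+3/2, 2j√3+3√3/2)` (the next sparse row).
The edges are the horizontal edges of the full rows together with the corner-sharing
up/down triangles through the sparse vertices `2` and `5`. -/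
def kagomeRel (n q : ℕ) :
    (Fin n × Fin q) × Fin 6 → (Fin n × Fin q) × Fin 6 → Prop :=
  fun x y =>
    (x.2 = 0 ∧ y.2 = 1 ∧ y.1 = x.1) ∨
    (x.2 = 1 ∧ y.2 = 0 ∧ finSucc x.1.1 y.1.1 ∧ y.1.2 = x.1.2) ∨
    (x.2 = 3 ∧ y.2 = 4 ∧ y.1 = x.1) ∨
    (x.2 = 4 ∧ y.2 = 3 ∧ finSucc x.1.1 y.1.1 ∧ y.1.2 = x.1.2) ∨
    (x.2 = 2 ∧ (y.2 = 0 ∨ y.2 = 1 ∨ y.2 = 3 ∨ y.2 = 4) ∧ y.1 = x.1) ∨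
    (x.2 = 5 ∧ ((y.2 = 4 ∧ y.1 = x.1) ∨
      (y.2 = 3 ∧ finSucc x.1.1 y.1.1 ∧ y.1.2 = x.1.2) ∨
      (y.2 = 1 ∧ y.1.1 = x.1.1 ∧ finSucc x.1.2 y.1.2) ∨
      (y.2 = 0 ∧ finSucc x.1.1 y.1.1 ∧ finSucc x.1.2 y.1.2)))

/-- The Kagome lattice with `n × q` cells of six vertices (periodic boundary
conditions). -/
def kagomeAux (n q : ℕ) : SimpleGraph ((Fin n × Fin q) × Fin 6) :=
  SimpleGraph.fromRel (kagomeRel n q)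

/-- The quotient `ℍ_{n,m}` of the Kagome (hexagonal dimer) lattice by the translation
group generated by `n·(2,0)` and `m·(0,√3)`; it has `3·n·m` vertices.  (One box of the
`kagomeAux` model has height `2√3`, hence accounts for two `(0,√3)`-translations.) -/
def kagomeGraph (n m : ℕ) : SimpleGraph ((Fin n × Fin (m / 2)) × Fin 6) :=
  kagomeAux n (m / 2)

end Kagome

structure IsAttach {ι A K Y : Type} [TopologicalSpace ι] [TopologicalSpace A]
    [TopologicalSpace K] [TopologicalSpace Y]
    (a : ι × A → K) (P : K ⊕ ((ι × A) × unitInterval) → Y) : Prop where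
  quot : Topology.IsQuotientMap P
  one : ∀ x, P (Sum.inr (x, 1)) = P (Sum.inl (a x))
  zero : ∀ s b b', P (Sum.inr ((s, b), 0)) = P (Sum.inr ((s, b'), 0))
  desc : ∀ z z', P z = P z' → ∀ (T : Type) (φ : K ⊕ ((ι × A) × unitInterval) → T),
    (∀ x, φ (Sum.inr (x, 1)) = φ (Sum.inl (a x))) →
    (∀ s b b', φ (Sum.inr ((s, b), 0)) = φ (Sum.inr ((s, b'), 0))) → φ z = φ z'

section Attach

variable {ι A K Y Y' : Type} [TopologicalSpace ι] [TopologicalSpace A]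
    [TopologicalSpace K] [TopologicalSpace Y] [TopologicalSpace Y']

theorem IsAttach.lift {a : ι × A → K} {P : K ⊕ ((ι × A) × unitInterval) → Y}
    (h : IsAttach a P) (φ : K ⊕ ((ι × A) × unitInterval) → Y') (hc : Continuous φ)
    (h1 : ∀ x, φ (Sum.inr (x, 1)) = φ (Sum.inl (a x)))
    (h0 : ∀ s b b', φ (Sum.inr ((s, b), 0)) = φ (Sum.inr ((s, b'), 0))) :
    ∃ F : C(Y, Y'), ∀ z, F (P z) = φ z := by
  have key : ∀ z, (φ ∘ Function.surjInv h.quot.surjective) (P z) = φ z := fun z =>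
    h.desc _ _ (Function.surjInv_eq h.quot.surjective (P z)) _ φ h1 h0
  refine ⟨⟨φ ∘ Function.surjInv h.quot.surjective, ?_⟩, key⟩
  rw [h.quot.continuous_iff]
  have : (φ ∘ Function.surjInv h.quot.surjective) ∘ P = φ := funext key
  rw [this]; exact hc

theorem IsAttach.liftHtpy {a : ι × A → K} {P : K ⊕ ((ι × A) × unitInterval) → Y}
    (h : IsAttach a P) (f g : C(Y, Y'))
    (φ : (K ⊕ ((ι × A) × unitInterval)) × unitInterval → Y') (hc : Continuous φ)
    (h1 : ∀ x u, φ (Sum.inr (x, 1), u) = φ (Sum.inl (a x), u))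
    (h0 : ∀ s b b' u, φ (Sum.inr ((s, b), 0), u) = φ (Sum.inr ((s, b'), 0), u))
    (hf : ∀ z, φ (z, 0) = f (P z)) (hg : ∀ z, φ (z, 1) = g (P z)) :
    f.Homotopic g := by
  let ψ : Y × unitInterval → Y' := fun p => φ (Function.surjInv h.quot.surjective p.1, p.2)
  have key : ∀ z u, ψ (P z, u) = φ (z, u) := fun z u =>
    h.desc _ _ (Function.surjInv_eq h.quot.surjective (P z)) _ (fun z => φ (z, u))
      (fun x => h1 x u) (fun s b b' => h0 s b b' u)
  have hψ : Continuous ψ := by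
    refine h.quot.continuous_lift_prod_left ?_
    have : (fun p : (K ⊕ ((ι × A) × unitInterval)) × unitInterval => ψ (P p.1, p.2)) = φ :=
      funext fun p => key p.1 p.2
    rw [this]; exact hc
  refine ⟨⟨⟨fun p => ψ (p.2, p.1), hψ.comp continuous_swap⟩, ?_, ?_⟩⟩
  · intro y
    obtain ⟨z, rfl⟩ := h.quot.surjective y
    exact (key z 0).trans (hf z)
  · intro y
    obtain ⟨z, rfl⟩ := h.quot.surjective y
    exact (key z 1).trans (hg z)

/-- the extended cylinder map -/
def cylMap (P : K ⊕ ((ι × A) × unitInterval) → Y) (H : (ι × A) × unitInterval → K)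
    (p : (ι × A) × ℝ) : Y :=
  if p.2 ≤ 1 then P (Sum.inr (p.1, Set.projIcc 0 1 zero_le_one p.2))
  else P (Sum.inl (H (p.1, Set.projIcc 0 1 zero_le_one (p.2 - 1))))

theorem cylMap_continuous {a : ι × A → K} {P : K ⊕ ((ι × A) × unitInterval) → Y}
    (h : IsAttach a P) {H : (ι × A) × unitInterval → K} (hH : Continuous H)
    (H0 : ∀ x, H (x, 0) = a x) : Continuous (cylMap P H) := by
  unfold cylMap
  have hP := h.quot.continuous
  refine Continuous.if_le ?_ ?_ continuous_snd continuous_const ?_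
  · exact hP.comp (continuous_inr.comp
      (continuous_fst.prodMk (continuous_projIcc.comp continuous_snd)))
  · exact hP.comp (continuous_inl.comp (hH.comp
      (continuous_fst.prodMk (continuous_projIcc.comp (continuous_snd.sub continuous_const)))))
  · rintro ⟨x, r⟩ hr
    simp only at hr
    subst hr
    have e1 : Set.projIcc (0:ℝ) 1 zero_le_one 1 = 1 := by simp
    have e0 : Set.projIcc (0:ℝ) 1 zero_le_one (1 - 1) = 0 := by simp
    simp only [e1, e0, H0]
    exact h.one x

theorem cylMap_of_le {P : K ⊕ ((ι × A) × unitInterval) → Y} {H : (ι × A) × unitInterval → K}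
    {x : ι × A} {r : ℝ} (t : unitInterval) (ht : (t : ℝ) = r) :
    cylMap P H (x, r) = P (Sum.inr (x, t)) := by
  subst ht
  have := t.2.2
  simp [cylMap, this]

theorem cylMap_of_ge {a : ι × A → K} {P : K ⊕ ((ι × A) × unitInterval) → Y}
    (h : IsAttach a P) {H : (ι × A) × unitInterval → K} (H0 : ∀ x, H (x, 0) = a x)
    {x : ι × A} {r : ℝ} (t : unitInterval) (ht : (t : ℝ) + 1 = r) :
    cylMap P H (x, r) = P (Sum.inl (H (x, t))) := by
  subst ht
  rcases eq_or_lt_of_le t.2.1 with h0 | h0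
  · have : t = 0 := Subtype.ext h0.symm
    subst this
    rw [H0, ← h.one, cylMap_of_le 1 (by simp)]
  · have : ¬ ((t : ℝ) + 1 ≤ 1) := by linarith
    simp [cylMap, this]

theorem attach_map {a a' : ι × A → K} {P : K ⊕ ((ι × A) × unitInterval) → Y}
    {P' : K ⊕ ((ι × A) × unitInterval) → Y'} (h : IsAttach a P) (h' : IsAttach a' P')
    {H : (ι × A) × unitInterval → K} (hH : Continuous H)
    (H0 : ∀ x, H (x, 0) = a' x) (H1 : ∀ x, H (x, 1) = a x) :
    ∃ F : C(Y, Y'), (∀ k, F (P (Sum.inl k)) = P' (Sum.inl k)) ∧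
      ∀ x (t : unitInterval), F (P (Sum.inr (x, t))) = cylMap P' H (x, 2 * (t : ℝ)) := by
  obtain ⟨F, hF⟩ := h.lift (Y' := Y')
    (Sum.elim (fun k => P' (Sum.inl k)) (fun p => cylMap P' H (p.1, 2 * (p.2 : ℝ)))) (by
      refine continuous_sumElim.2 ⟨h'.quot.continuous.comp continuous_inl, ?_⟩
      exact (cylMap_continuous h' hH H0).comp (by fun_prop))
    (by
      intro x
      simp only [Sum.elim_inr, Sum.elim_inl]
      rw [cylMap_of_ge h' H0 1 (by norm_num), H1])
    (by
      intro s b b'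
      simp only [Sum.elim_inr]
      rw [cylMap_of_le 0 (by simp), cylMap_of_le 0 (by simp)]
      exact h'.zero s b b')
  exact ⟨F, fun k => hF _, fun x t => hF _⟩

theorem attach_comp {a a' : ι × A → K} {P : K ⊕ ((ι × A) × unitInterval) → Y}
    {P' : K ⊕ ((ι × A) × unitInterval) → Y'} (h : IsAttach a P) (h' : IsAttach a' P')
    {H H' : (ι × A) × unitInterval → K} (hH : Continuous H)
    (H0 : ∀ x, H (x, 0) = a x) (H1 : ∀ x, H (x, 1) = a' x)
    (HH : ∀ x t, H' (x, t) = H (x, unitInterval.symm t))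
    (F : C(Y, Y')) (G : C(Y', Y))
    (F1 : ∀ k, F (P (Sum.inl k)) = P' (Sum.inl k))
    (F2 : ∀ x (t : unitInterval), F (P (Sum.inr (x, t))) = cylMap P' H' (x, 2 * (t : ℝ)))
    (G1 : ∀ k, G (P' (Sum.inl k)) = P (Sum.inl k))
    (G2 : ∀ x (t : unitInterval), G (P' (Sum.inr (x, t))) = cylMap P H (x, 2 * (t : ℝ))) :
    (G.comp F).Homotopic (ContinuousMap.id Y) := by
  have H0' : ∀ x, H' (x, 0) = a' x := fun x => by rw [HH, unitInterval.symm_zero, H1]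
  let ρ : unitInterval × unitInterval → ℝ := fun p =>
    (1 - (p.2 : ℝ)) * min (4 * (p.1 : ℝ)) (3 - 2 * (p.1 : ℝ)) + (p.2 : ℝ) * (p.1 : ℝ)
  have hρ : Continuous ρ := by fun_prop
  let φ : (K ⊕ ((ι × A) × unitInterval)) × unitInterval → Y := fun q =>
    Sum.elim (fun k => P (Sum.inl k)) (fun p => cylMap P H (p.1, ρ (p.2, q.2))) q.1
  have hφ : Continuous φ := by
    have e : φ ∘ (Homeomorph.sumProdDistrib (X := K) (Y := (ι × A) × unitInterval)
        (Z := unitInterval)).symm =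
        Sum.elim (fun k => P (Sum.inl k.1)) (fun p => cylMap P H (p.1.1, ρ (p.1.2, p.2))) := by
      funext z
      rcases z with z | z <;> rfl
    rw [← (Homeomorph.sumProdDistrib (X := K) (Y := (ι × A) × unitInterval)
        (Z := unitInterval)).symm.comp_continuous_iff', e]
    refine continuous_sumElim.2
      ⟨h.quot.continuous.comp (continuous_inl.comp continuous_fst), ?_⟩
    exact (cylMap_continuous h hH H0).comp (by fun_prop)
  refine h.liftHtpy _ _ φ hφ ?_ ?_ ?_ ?_
  · intro x u
    simp only [φ, Sum.elim_inr, Sum.elim_inl]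
    rw [cylMap_of_le 1, h.one]
    simp only [ρ, Set.Icc.coe_one]
    norm_num
  · intro s b b' u
    simp only [φ, Sum.elim_inr]
    have : ((0 : unitInterval) : ℝ) = ρ (0, u) := by simp [ρ]
    rw [cylMap_of_le 0 this, cylMap_of_le 0 this]
    exact h.zero s b b'
  · rintro (k | ⟨x, t⟩)
    · simp [φ, F1, G1]
    · simp only [φ, Sum.elim_inr, ContinuousMap.comp_apply]
      have t0 := t.2.1
      have t1 := t.2.2
      rw [F2]
      rcases le_total (t : ℝ) (1/2) with ht | ht
      · rw [cylMap_of_le (⟨2 * (t : ℝ), by constructor <;> linarith⟩ : unitInterval) rfl, G2]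
        congr 2
        simp only [ρ, Set.Icc.coe_zero]
        rw [min_eq_left (by linarith)]
        ring
      · rw [cylMap_of_ge h' H0' (⟨2 * (t : ℝ) - 1, by constructor <;> linarith⟩ : unitInterval)
          (by simp), G1, HH]
        rw [cylMap_of_ge h H0]
        simp only [ρ, Set.Icc.coe_zero, unitInterval.coe_symm_eq]
        rw [min_eq_right (by linarith)]
        ring
  · rintro (k | ⟨x, t⟩)
    · simp [φ]
    · simp only [φ, Sum.elim_inr, ContinuousMap.id_apply]
      rw [cylMap_of_le t]
      simp [ρ]

theorem attach_equiv {a a' : ι × A → K} {P : K ⊕ ((ι × A) × unitInterval) → Y}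
    {P' : K ⊕ ((ι × A) × unitInterval) → Y'} (h : IsAttach a P) (h' : IsAttach a' P')
    {H : (ι × A) × unitInterval → K} (hH : Continuous H)
    (H0 : ∀ x, H (x, 0) = a x) (H1 : ∀ x, H (x, 1) = a' x) :
    Nonempty (ContinuousMap.HomotopyEquiv Y Y') := by
  let H' : (ι × A) × unitInterval → K := fun p => H (p.1, unitInterval.symm p.2)
  have hH' : Continuous H' := by fun_prop
  have H0' : ∀ x, H' (x, 0) = a' x := fun x => by simp [H', H1]
  have H1' : ∀ x, H' (x, 1) = a x := fun x => by simp [H', H0]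
  obtain ⟨F, F1, F2⟩ := attach_map h h' hH' H0' H1'
  obtain ⟨G, G1, G2⟩ := attach_map h' h hH H0 H1
  exact ⟨⟨F, G, attach_comp h h' hH H0 H1 (fun _ _ => rfl) F G F1 F2 G1 G2,
    attach_comp h' h hH' H0' H1' (fun x t => by simp [H']) G F G1 G2 F1 F2⟩⟩

end Attach

/-- boundary of the standard simplex -/
def BdA (d : ℕ) : Type :=
  {b : Fin d → ℝ // (∀ i, 0 ≤ b i) ∧ ∑ i, b i = 1 ∧ ∃ i, b i = 0}

instance (d : ℕ) : TopologicalSpace (BdA d) := by unfold BdA; infer_instance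
instance (d : ℕ) : T2Space (BdA d) := by unfold BdA; infer_instance

theorem BdA.continuous_val (d : ℕ) : Continuous (fun b : BdA d => b.1) := continuous_subtype_val

theorem BdA.continuous_coord (d : ℕ) (i : Fin d) : Continuous (fun b : BdA d => b.1 i) :=
  (continuous_apply i).comp (BdA.continuous_val d)

instance (d : ℕ) : CompactSpace (BdA d) := by
  have hcl : IsCompact {b : Fin d → ℝ | (∀ i, 0 ≤ b i) ∧ ∑ i, b i = 1 ∧ ∃ i, b i = 0} := by
    refine (isCompact_stdSimplex ℝ (Fin d)).of_isClosed_subset ?_ ?_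
    · refine IsClosed.inter ?_ (IsClosed.inter ?_ ?_)
      · have : {b : Fin d → ℝ | ∀ i, 0 ≤ b i} = ⋂ i, {b | 0 ≤ b i} := by ext; simp
        change IsClosed {b : Fin d → ℝ | ∀ i, 0 ≤ b i}
        rw [this]
        exact isClosed_iInter fun i => isClosed_le continuous_const (continuous_apply i)
      · exact isClosed_eq (by fun_prop) continuous_const
      · have : {b : Fin d → ℝ | ∃ i, b i = 0} = ⋃ i, {b | b i = 0} := by ext; simp
        change IsClosed {b : Fin d → ℝ | ∃ i, b i = 0}
        rw [this]
        exact isClosed_iUnion_of_finite fun i => isClosed_eq (continuous_apply i) continuous_const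
    · intro b hb
      exact ⟨hb.1, hb.2.1⟩
  exact isCompact_iff_compactSpace.1 hcl

theorem BdA.nonempty {d : ℕ} (hd : 2 ≤ d) : Nonempty (BdA d) := by
  refine ⟨⟨Pi.single ⟨0, by omega⟩ 1, ?_, ?_, ⟨⟨1, by omega⟩, ?_⟩⟩⟩
  · intro i
    by_cases h : i = ⟨0, by omega⟩
    · subst h; simp
    · simp [Pi.single_eq_of_ne h]
  · simp
  · apply Pi.single_eq_of_ne
    simp [Fin.ext_iff]

section Sphere
variable {d : ℕ}

def bdir (b : BdA d) : EuclideanSpace ℝ (Fin d) := WithLp.toLp 2 (fun i => b.1 i - 1 / d)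
def evec (d : ℕ) : EuclideanSpace ℝ (Fin d) := WithLp.toLp 2 (fun _ => 1 / Real.sqrt d)

theorem bdir_ne (hd : 2 ≤ d) (b : BdA d) : bdir b ≠ 0 := by
  intro h
  obtain ⟨i, hi⟩ := b.2.2.2
  have := congrArg (fun x : EuclideanSpace ℝ (Fin d) => x i) h
  simp [bdir, hi] at this
  omega

theorem norm_evec (hd : 2 ≤ d) : ‖evec d‖ = 1 := by
  have : (0:ℝ) < d := by positivity
  rw [EuclideanSpace.norm_eq]
  simp [evec, this.ne']

theorem inner_evec (x : EuclideanSpace ℝ (Fin d)) :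
    inner ℝ (evec d) x = (1 / Real.sqrt d) * ∑ i, x i := by
  rw [Finset.mul_sum]
  simp [PiLp.inner_apply, evec, mul_comm]

theorem sum_bdir (hd : 2 ≤ d) (b : BdA d) : ∑ i, bdir b i = 0 := by
  have : (d:ℝ) ≠ 0 := by positivity
  simp [bdir, Finset.sum_sub_distrib, b.2.2.1, this]

def budir (b : BdA d) : EuclideanSpace ℝ (Fin d) := ‖bdir b‖⁻¹ • bdir b

theorem norm_budir (hd : 2 ≤ d) (b : BdA d) : ‖budir b‖ = 1 := by
  have := norm_ne_zero_iff.2 (bdir_ne hd b)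
  simp [budir, norm_smul, this]

theorem inner_budir (hd : 2 ≤ d) (b : BdA d) : inner ℝ (evec d) (budir b) = 0 := by
  rw [budir, inner_smul_right, inner_evec, sum_bdir hd b]; simp

theorem bdir_continuous : Continuous (bdir (d := d)) := by
  unfold bdir
  refine (PiLp.continuous_toLp 2 _).comp ?_
  exact continuous_pi fun i => (BdA.continuous_coord d i).sub continuous_const

theorem budir_continuous (hd : 2 ≤ d) : Continuous (budir (d := d)) := by
  unfold budir
  exact (bdir_continuous.norm.inv₀ fun b => norm_ne_zero_iff.2 (bdir_ne hd b)).smul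
    bdir_continuous

theorem bdir_le (hd : 2 ≤ d) (b b' : BdA d) (κ : ℝ) (hκ : 0 < κ) (h : bdir b = κ • bdir b') :
    1 ≤ κ := by
  obtain ⟨i, hi⟩ := b.2.2.2
  have h1 := congrArg (fun x : EuclideanSpace ℝ (Fin d) => x i) h
  have h2 := b'.2.1 i
  have h3 : (0:ℝ) < 1 / d := by positivity
  simp only [bdir, hi, PiLp.smul_apply, smul_eq_mul] at h1
  by_contra hlt
  push Not at hlt
  nlinarith [mul_nonneg hκ.le h2]

theorem budir_inj (hd : 2 ≤ d) (b b' : BdA d) (h : budir b = budir b') : b = b' := by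
  have n1 := norm_pos_iff.2 (bdir_ne hd b)
  have n2 := norm_pos_iff.2 (bdir_ne hd b')
  have e1 : bdir b = (‖bdir b‖ * ‖bdir b'‖⁻¹) • bdir b' := by
    have : bdir b = ‖bdir b‖ • budir b := by
      rw [budir, smul_smul, mul_inv_cancel₀ n1.ne', one_smul]
    rw [this, h, budir, smul_smul]
    simp [norm_smul, n2.ne']
  have e2 : bdir b' = (‖bdir b'‖ * ‖bdir b‖⁻¹) • bdir b := by
    have : bdir b' = ‖bdir b'‖ • budir b' := by
      rw [budir, smul_smul, mul_inv_cancel₀ n2.ne', one_smul]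
    rw [this, ← h, budir, smul_smul]
    simp [norm_smul, n1.ne']
  have k1 := bdir_le hd b b' _ (by positivity) e1
  have k2 := bdir_le hd b' b _ (by positivity) e2
  rw [← div_eq_mul_inv, one_le_div n2] at k1
  rw [← div_eq_mul_inv, one_le_div n1] at k2
  have : ‖bdir b‖ = ‖bdir b'‖ := le_antisymm k2 k1
  rw [this, mul_inv_cancel₀ n2.ne', one_smul] at e1
  apply Subtype.ext
  funext i
  have := congrArg (fun x : EuclideanSpace ℝ (Fin d) => x i) e1
  simpa [bdir] using this

theorem exists_budir (hd : 2 ≤ d) (w : EuclideanSpace ℝ (Fin d)) (hw : ∑ i, w i = 0) :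
    ∃ b : BdA d, ‖w‖ • budir b = w := by
  by_cases h0 : w = 0
  · obtain ⟨b⟩ := BdA.nonempty hd
    exact ⟨b, by simp [h0]⟩
  have : Nonempty (Fin d) := ⟨⟨0, by omega⟩⟩
  have hd0 : (0:ℝ) < d := by positivity
  obtain ⟨i0, hi0⟩ := Finite.exists_min (fun i => w i)
  have hneg : w i0 < 0 := by
    by_contra hge
    push Not at hge
    apply h0
    have hz := (Finset.sum_eq_zero_iff_of_nonneg (s := Finset.univ) (f := fun i => w i)
      (fun i _ => hge.trans (hi0 i))).1 hw
    ext i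
    simpa using hz i (Finset.mem_univ _)
  have hl : 0 < 1 / (d * (- w i0)) := by
    apply one_div_pos.2
    exact mul_pos hd0 (by linarith)
  set l := 1 / (d * (- w i0)) with hldef
  have hl0 : 1 / (d:ℝ) + l * w i0 = 0 := by
    have := hneg.ne
    rw [hldef]; field_simp; norm_num
  have hnn : ∀ i, 0 ≤ 1 / (d:ℝ) + l * w i := fun i => by
    have := mul_le_mul_of_nonneg_left (hi0 i) hl.le
    linarith
  let b : BdA d := ⟨fun i => 1 / d + l * w i, hnn, by
    rw [Finset.sum_add_distrib, ← Finset.mul_sum, hw]; simp [hd0.ne'], ⟨i0, hl0⟩⟩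
  have hb : bdir b = l • w := by
    ext i; simp [bdir, b]
  refine ⟨b, ?_⟩
  rw [budir, hb, norm_smul, smul_smul, smul_smul, Real.norm_of_nonneg hl.le]
  have hn := norm_ne_zero_iff.2 h0
  have : ‖w‖ * (l * ‖w‖)⁻¹ * l = 1 := by field_simp
  rw [this, one_smul]

def suspVec (p : BdA d × unitInterval) : EuclideanSpace ℝ (Fin d) :=
  Real.cos (Real.pi * p.2) • evec d + Real.sin (Real.pi * p.2) • budir p.1

theorem norm_suspVec (hd : 2 ≤ d) (p : BdA d × unitInterval) : ‖suspVec p‖ = 1 := by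
  have : ‖suspVec p‖ * ‖suspVec p‖ = 1 := by
    rw [suspVec, norm_add_sq_eq_norm_sq_add_norm_sq_real]
    · simp only [norm_smul, norm_evec hd, norm_budir hd, Real.norm_eq_abs, mul_one,
        abs_mul_abs_self]
      nlinarith [Real.cos_sq_add_sin_sq (Real.pi * p.2)]
    · simp [inner_smul_left, inner_smul_right, inner_budir hd]
  nlinarith [norm_nonneg (suspVec p)]

theorem inner_suspVec (hd : 2 ≤ d) (p : BdA d × unitInterval) :
    inner ℝ (evec d) (suspVec p) = Real.cos (Real.pi * p.2) := by
  simp [suspVec, inner_add_right, inner_smul_right, inner_budir hd, norm_evec hd]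

theorem susp_quot (hd : 2 ≤ d) :
    ∃ q : BdA d × unitInterval → Metric.sphere (0 : EuclideanSpace ℝ (Fin d)) 1,
      Continuous q ∧ Function.Surjective q ∧ (∀ b b', q (b, 0) = q (b', 0)) ∧
      (∀ b b', q (b, 1) = q (b', 1)) ∧
      ∀ b t b' t', q (b, t) = q (b', t') → t = t' ∧ (t = 0 ∨ t = 1 ∨ b = b') := by
  refine ⟨fun p => ⟨suspVec p, by simp [norm_suspVec hd]⟩, ?_, ?_, ?_, ?_, ?_⟩
  · refine Continuous.subtype_mk ?_ _
    unfold suspVec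
    have := budir_continuous hd
    fun_prop
  · rintro ⟨x, hx⟩
    have hx1 : ‖x‖ = 1 := by simpa using hx
    set α : ℝ := inner ℝ (evec d) x with hα
    have hd0 : (0:ℝ) < d := by positivity
    have habs : |α| ≤ 1 := by
      have := abs_real_inner_le_norm (evec d) x
      rwa [norm_evec hd, hx1, one_mul] at this
    rw [abs_le] at habs
    set w := x - α • evec d with hw
    have hin : inner ℝ (evec d) w = 0 := by
      rw [hw, inner_sub_right, inner_smul_right, real_inner_self_eq_norm_sq, norm_evec hd]
      simp [hα]
    have hsum : ∑ i, w i = 0 := by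
      rw [inner_evec] at hin
      rcases mul_eq_zero.1 hin with h | h
      · exfalso
        have : (0:ℝ) < 1 / Real.sqrt d := by positivity
        linarith
      · exact h
    obtain ⟨b, hb⟩ := exists_budir hd w hsum
    have hxw : x = α • evec d + w := by rw [hw]; abel
    have hnw : ‖w‖ = Real.sqrt (1 - α ^ 2) := by
      have h1 : ‖x‖ * ‖x‖ = ‖α • evec d‖ * ‖α • evec d‖ + ‖w‖ * ‖w‖ := by
        conv_lhs => rw [hxw]
        exact norm_add_sq_eq_norm_sq_add_norm_sq_real (x := α • evec d) (y := w)
          (by rw [inner_smul_left, hin]; simp)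
      simp only [hx1, norm_smul, norm_evec hd, Real.norm_eq_abs, mul_one, abs_mul_abs_self] at h1
      rw [eq_comm, Real.sqrt_eq_iff_mul_self_eq (by nlinarith) (norm_nonneg _)]
      nlinarith
    have hpi := Real.pi_pos
    refine ⟨(b, ⟨Real.arccos α / Real.pi, div_nonneg (Real.arccos_nonneg _) hpi.le,
      (div_le_one hpi).2 (Real.arccos_le_pi _)⟩), Subtype.ext ?_⟩
    simp only [suspVec]
    rw [mul_div_cancel₀ _ hpi.ne', Real.cos_arccos habs.1 habs.2, Real.sin_arccos, ← hnw, hb,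
      ← hxw]
  · intro b b'
    simp [suspVec]
  · intro b b'
    simp [suspVec]
  · intro b t b' t' h
    have h' : suspVec (b, t) = suspVec (b', t') := congrArg Subtype.val h
    have hc : Real.cos (Real.pi * t) = Real.cos (Real.pi * t') := by
      have := congrArg (fun x => inner ℝ (evec d) x) h'
      simpa only [inner_suspVec hd] using this
    have hpi := Real.pi_pos
    have ht : (t : ℝ) = t' := by
      have := Real.injOn_cos
        (x₁ := Real.pi * t) ⟨mul_nonneg hpi.le t.2.1, by nlinarith [t.2.2]⟩
        (x₂ := Real.pi * t') ⟨mul_nonneg hpi.le t'.2.1, by nlinarith [t'.2.2]⟩ hc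
      exact mul_left_cancel₀ hpi.ne' this
    have ht' : t = t' := Subtype.ext ht
    subst ht'
    refine ⟨rfl, ?_⟩
    by_cases h0 : t = 0
    · exact Or.inl h0
    by_cases h1 : t = 1
    · exact Or.inr (Or.inl h1)
    right; right
    have p0 : (0:ℝ) < t := lt_of_le_of_ne t.2.1 fun h => h0 (Subtype.ext h.symm)
    have p1 : (t:ℝ) < 1 := lt_of_le_of_ne t.2.2 fun h => h1 (Subtype.ext h)
    have hs : 0 < Real.sin (Real.pi * t) :=
      Real.sin_pos_of_pos_of_lt_pi (by positivity) (by nlinarith)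
    simp only [suspVec] at h'
    have := smul_right_injective _ hs.ne' (add_left_cancel h')
    exact budir_inj hd _ _ this

end Sphere

theorem wedge_attach {N d : ℕ} (hd : 2 ≤ d) (s0 : Fin N) {K : Type} [TopologicalSpace K]
    (p : K) :
    ∃ (pt : Fin N → Metric.sphere (0 : EuclideanSpace ℝ (Fin d)) 1)
      (w0 : PtdWedge (fun _ : Fin N => Metric.sphere (0 : EuclideanSpace ℝ (Fin d)) 1) pt)
      (P : K ⊕ ((Fin N × BdA d) × unitInterval) →
        Wedge2 (PtdWedge (fun _ : Fin N => Metric.sphere (0 : EuclideanSpace ℝ (Fin d)) 1) pt)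
          K w0 p), IsAttach (fun _ : Fin N × BdA d => p) P := by
  obtain ⟨q, hq, hqs, hq0, hq1, hqf⟩ := susp_quot hd
  obtain ⟨b0⟩ := BdA.nonempty hd
  have hqq : Topology.IsQuotientMap q := Topology.IsQuotientMap.of_surjective_continuous hqs hq
  let S := Metric.sphere (0 : EuclideanSpace ℝ (Fin d)) 1
  let pt : Fin N → S := fun _ => q (b0, 1)
  let w0 : PtdWedge (fun _ : Fin N => S) pt := Quot.mk _ ⟨s0, pt s0⟩
  let P : K ⊕ ((Fin N × BdA d) × unitInterval) →
        Wedge2 (PtdWedge (fun _ : Fin N => S) pt) K w0 p :=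
    Sum.elim (fun k => Quot.mk _ (Sum.inr k))
      (fun x => Quot.mk _ (Sum.inl (Quot.mk _ ⟨x.1.1, q (x.1.2, x.2)⟩)))
  let ms : Fin N → S → Wedge2 (PtdWedge (fun _ : Fin N => S) pt) K w0 p :=
    fun s x => Quot.mk _ (Sum.inl (Quot.mk _ ⟨s, x⟩))
  have hglue : ∀ s, (Quot.mk _ (Sum.inl (Quot.mk _ ⟨s, pt s⟩)) :
      Wedge2 (PtdWedge (fun _ : Fin N => S) pt) K w0 p) = Quot.mk _ (Sum.inr p) := by
    intro s
    have e : (Quot.mk _ ⟨s, pt s⟩ : PtdWedge (fun _ : Fin N => S) pt) = w0 :=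
      Quot.sound ⟨⟨s, rfl⟩, ⟨s0, rfl⟩⟩
    rw [e]
    exact Quot.sound ⟨rfl, rfl⟩
  have hPc : Continuous P := by
    refine continuous_sumElim.2 ⟨continuous_quot_mk.comp continuous_inr, ?_⟩
    refine continuous_quot_mk.comp (continuous_inl.comp (continuous_quot_mk.comp ?_))
    have : Continuous fun x : Fin N × (BdA d × unitInterval) =>
        (⟨x.1, q x.2⟩ : Σ _ : Fin N, S) :=
      continuous_prod_of_discrete_left.2 fun s => continuous_sigmaMk.comp hq
    exact this.comp (f := fun x : (Fin N × BdA d) × unitInterval => (x.1.1, (x.1.2, x.2)))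
      (by fun_prop)
  refine ⟨pt, w0, P, ⟨?_, ?_, ?_, ?_⟩⟩
  · refine ⟨?_, ?_⟩
    rotate_left
    · rintro ⟨(⟨⟨s, x⟩⟩ | k)⟩
      · obtain ⟨⟨b, t⟩, rfl⟩ := hqs x
        exact ⟨Sum.inr ((s, b), t), rfl⟩
      · exact ⟨Sum.inl k, rfl⟩
    · refine Topology.isCoinducing_iff.2 fun U => ?_
      refine ⟨fun h => ?_, fun h => h.preimage hPc⟩
      rw [isOpen_sum_iff] at h
      refine isQuotientMap_quot_mk.isOpen_preimage.1 (isOpen_sum_iff.2 ⟨?_, h.1⟩)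
      refine isQuotientMap_quot_mk.isOpen_preimage.1 (isOpen_sigma_iff.2 fun s => ?_)
      rw [← hqq.isOpen_preimage]
      exact h.2.preimage (f := fun x : BdA d × unitInterval => ((s, x.1), x.2)) (by fun_prop)
  · rintro ⟨s, b⟩
    exact (congrArg (ms s) (hq1 b b0)).trans (hglue s)
  · intro s b b'
    exact congrArg (ms s) (hq0 b b')
  · intro z z' hz T φ h1 h0
    have key : ∀ s b t b' t', q (b, t) = q (b', t') →
        φ (Sum.inr ((s, b), t)) = φ (Sum.inr ((s, b'), t')) := by
      intro s b t b' t' h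
      obtain ⟨rfl, h | h | h⟩ := hqf _ _ _ _ h
      · subst h; exact h0 _ _ _
      · subst h; rw [h1, h1]
      · subst h; rfl
    let f : (Σ _ : Fin N, S) → T := fun x =>
      φ (Sum.inr ((x.1, (Function.surjInv hqs x.2).1), (Function.surjInv hqs x.2).2))
    have hf : ∀ s b t, f ⟨s, q (b, t)⟩ = φ (Sum.inr ((s, b), t)) := fun s b t =>
      key _ _ _ _ _ (Function.surjInv_eq hqs (q (b, t)))
    have hfp : ∀ s, f ⟨s, pt s⟩ = φ (Sum.inl p) := fun s => (hf s b0 1).trans (h1 _)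
    let g : PtdWedge (fun _ : Fin N => S) pt → T := Quot.lift f (by
      rintro _ _ ⟨⟨i, rfl⟩, ⟨j, rfl⟩⟩
      rw [hfp, hfp])
    let ψ : Wedge2 (PtdWedge (fun _ : Fin N => S) pt) K w0 p → T :=
      Quot.lift (Sum.elim g (fun k => φ (Sum.inl k))) (by
        rintro _ _ ⟨rfl, rfl⟩
        exact hfp s0)
    have hψ : ∀ z, ψ (P z) = φ z := by
      rintro (k | ⟨⟨s, b⟩, t⟩)
      · rfl
      · exact hf s b t
    rw [← hψ z, ← hψ z', hz]

theorem cont_disc {N : ℕ} {B T : Type} [TopologicalSpace B] [TopologicalSpace T]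
    (f : (Fin N × B) × unitInterval → T)
    (h : ∀ s, Continuous (fun p : B × unitInterval => f ((s, p.1), p.2))) : Continuous f := by
  have h1 : Continuous (fun q : Fin N × (B × unitInterval) => f ((q.1, q.2.1), q.2.2)) :=
    continuous_prod_of_discrete_left.2 h
  exact h1.comp (g := fun q : Fin N × (B × unitInterval) => f ((q.1, q.2.1), q.2.2))
    (f := fun p : (Fin N × B) × unitInterval => (p.1.1, (p.1.2, p.2))) (by fun_prop)

section RealAttach

variable {V : Type}

/-- push a weighting forward along a family of vertices -/
def wt {d : ℕ} (u : Fin d → V) (x : Fin d → ℝ) : V → ℝ :=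
  fun y => ∑ i, if u i = y then x i else 0

theorem wt_nonneg {d : ℕ} (u : Fin d → V) (x : Fin d → ℝ) (hx : ∀ i, 0 ≤ x i) (y : V) :
    0 ≤ wt u x y := by
  unfold wt
  refine Finset.sum_nonneg fun i _ => ?_
  split_ifs
  · exact hx i
  · exact le_rfl

theorem sum_wt [Fintype V] {d : ℕ} (u : Fin d → V) (x : Fin d → ℝ) :
    ∑ y, wt u x y = ∑ i, x i := by
  unfold wt
  rw [Finset.sum_comm]
  refine Finset.sum_congr rfl fun i _ => ?_
  simp

theorem wt_ne {d : ℕ} {u : Fin d → V} {x : Fin d → ℝ} {y : V} (h : wt u x y ≠ 0) :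
    ∃ i, u i = y ∧ x i ≠ 0 := by
  unfold wt at h
  obtain ⟨i, -, hi⟩ := Finset.exists_ne_zero_of_sum_ne_zero h
  by_cases hu : u i = y
  · exact ⟨i, hu, by simpa [hu] using hi⟩
  · simp [hu] at hi

theorem wt_inj {d : ℕ} {u : Fin d → V} (hu : Function.Injective u) (x : Fin d → ℝ) (i : Fin d) :
    wt u x (u i) = x i := by
  unfold wt
  rw [Finset.sum_eq_single i]
  · simp
  · intro j _ hj
    rw [if_neg (fun h => hj (hu h))]
  · simp

theorem wt_zero {d : ℕ} {u : Fin d → V} {x : Fin d → ℝ} {y : V} (h : ∀ i, u i = y → x i = 0) :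
    wt u x y = 0 := by
  by_contra hne
  obtain ⟨i, h1, h2⟩ := wt_ne hne
  exact h2 (h i h1)

theorem wt_continuous {d : ℕ} (u : Fin d → V) {T : Type} [TopologicalSpace T]
    (x : T → Fin d → ℝ) (hx : ∀ i, Continuous (fun t => x t i)) (y : V) :
    Continuous (fun t => wt u (x t) y) := by
  unfold wt
  refine continuous_finsetSum _ fun i _ => ?_
  split_ifs
  · exact hx i
  · exact continuous_const

structure SplitData (K : SComplex V) {N d : ℕ} (v w : Fin N → Fin d → V) : Prop where
  inj : ∀ s, Function.Injective (v s)
  max : ∀ s, ∀ f ∈ K.faces, (∀ i, v s i ∈ f) → ∀ y ∈ f, ∃ i, y = v s i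
  choice : ∀ s (c : Fin d → Prop) (f : Finset V),
    (∀ y ∈ f, ∃ i, (y = v s i ∧ ¬ c i) ∨ (y = w s i ∧ c i)) → f ∈ K.faces
  dist : ∀ s s', s ≠ s' → ∃ i, ∀ j, v s' i ≠ v s j ∧ v s' i ≠ w s j
  own : ∀ s i j, v s i ≠ w s j

variable [Fintype V]

theorem realization_continuous_coord (K : SComplex V) (y : V) :
    Continuous (fun f : realization K => f.1 y) :=
  (continuous_apply y).comp continuous_subtype_val

instance realization_t2 (K : SComplex V) : T2Space (realization K) := by
  unfold realization; infer_instance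

instance realization_compact (K : SComplex V) : CompactSpace (realization K) := by
  have hcl : IsCompact {f : V → ℝ | (∀ v, 0 ≤ f v) ∧ (∑ v, f v) = 1 ∧
      Finset.univ.filter (fun v => f v ≠ 0) ∈ K.faces} := by
    refine (isCompact_stdSimplex ℝ V).of_isClosed_subset ?_ ?_
    · refine IsClosed.inter ?_ (IsClosed.inter ?_ ?_)
      · have : {b : V → ℝ | ∀ i, 0 ≤ b i} = ⋂ i, {b | 0 ≤ b i} := by ext; simp
        change IsClosed {b : V → ℝ | ∀ i, 0 ≤ b i}
        rw [this]
        exact isClosed_iInter fun i => isClosed_le continuous_const (continuous_apply i)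
      · exact isClosed_eq (by fun_prop) continuous_const
      · have : {f : V → ℝ | Finset.univ.filter (fun v => f v ≠ 0) ∈ K.faces} =
            ⋃ τ : K.faces, ⋂ y : V, {f : V → ℝ | y ∉ τ.1 → f y = 0} := by
          ext f
          simp only [Set.mem_setOf_eq, Set.mem_iUnion, Set.mem_iInter]
          constructor
          · intro h
            exact ⟨⟨_, h⟩, fun y hy => by simpa using hy⟩
          · rintro ⟨τ, hτ⟩
            refine K.down_closed τ.2 fun y hy => ?_
            by_contra hn
            exact (Finset.mem_filter.1 hy).2 (hτ y hn)
        change IsClosed {f : V → ℝ | Finset.univ.filter (fun v => f v ≠ 0) ∈ K.faces}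
        rw [this]
        refine isClosed_iUnion_of_finite fun τ => isClosed_iInter fun y => ?_
        by_cases hy : y ∈ τ.1
        · simp [hy]
        · simp only [hy, not_false_eq_true, forall_const]
          exact isClosed_eq (continuous_apply y) continuous_const
    · intro b hb
      exact ⟨hb.1, hb.2.1⟩
  exact isCompact_iff_compactSpace.1 hcl

variable {N d : ℕ}

def KS (K : SComplex V) (v : Fin N → Fin d → V) : Type :=
  {f : realization K // ∀ s, ∃ i, f.1 (v s i) = 0}

instance (K : SComplex V) (v : Fin N → Fin d → V) : TopologicalSpace (KS K v) := by
  unfold KS; infer_instance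

instance (K : SComplex V) (v : Fin N → Fin d → V) : CompactSpace (KS K v) := by
  have : IsClosed {f : realization K | ∀ s, ∃ i, f.1 (v s i) = 0} := by
    have : {f : realization K | ∀ s, ∃ i, f.1 (v s i) = 0} =
        ⋂ s, ⋃ i, {f : realization K | f.1 (v s i) = 0} := by ext; simp
    rw [this]
    exact isClosed_iInter fun s => isClosed_iUnion_of_finite fun i =>
      isClosed_eq (realization_continuous_coord K _) continuous_const
  exact isCompact_iff_compactSpace.1 this.isCompact

variable {K : SComplex V} {v w : Fin N → Fin d → V}

/-- the points of the simplex indexed by `s` -/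
def RP (h : SplitData K v w) (s : Fin N) (x : Fin d → ℝ) (h0 : ∀ i, 0 ≤ x i)
    (h1 : ∑ i, x i = 1) : realization K :=
  ⟨wt (v s) x, wt_nonneg _ _ h0, by rw [sum_wt, h1], by
    refine h.choice s (fun _ => False) _ fun y hy => ?_
    obtain ⟨i, hi, -⟩ := wt_ne (Finset.mem_filter.1 hy).2
    exact ⟨i, Or.inl ⟨hi.symm, not_false⟩⟩⟩

def aMap (h : SplitData K v w) (p : Fin N × BdA d) : KS K v :=
  ⟨RP h p.1 p.2.1 p.2.2.1 p.2.2.2.1, by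
    intro s
    by_cases hs : p.1 = s
    · subst hs
      obtain ⟨i, hi⟩ := p.2.2.2.2
      exact ⟨i, (wt_inj (h.inj _) _ i).trans hi⟩
    · obtain ⟨i, hi⟩ := h.dist _ _ hs
      exact ⟨i, wt_zero fun j hj => absurd hj.symm (hi j).1⟩⟩

def cvx (b : BdA d) (t : unitInterval) (i : Fin d) : ℝ := (1 - (t : ℝ)) / d + t * b.1 i

theorem cvx_nonneg (b : BdA d) (t : unitInterval) (i : Fin d) : 0 ≤ cvx b t i := by
  have h1 := b.2.1 i
  have h2 := t.2.1
  have h3 : (0:ℝ) ≤ 1 - t := by linarith [t.2.2]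
  unfold cvx
  positivity

theorem cvx_sum (hd : 2 ≤ d) (b : BdA d) (t : unitInterval) : ∑ i, cvx b t i = 1 := by
  have : (d : ℝ) ≠ 0 := by positivity
  simp only [cvx, Finset.sum_add_distrib, ← Finset.mul_sum, b.2.2.1]
  simp
  field_simp
  ring

theorem cvx_pos (hd : 2 ≤ d) (b : BdA d) (t : unitInterval) (ht : t ≠ 1) (i : Fin d) :
    0 < cvx b t i := by
  have h1 := b.2.1 i
  have h2 := t.2.1
  have h3 : (0:ℝ) < 1 - t := by
    have : (t : ℝ) < 1 := lt_of_le_of_ne t.2.2 (fun h => ht (Subtype.ext h))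
    linarith
  have : (0:ℝ) < d := by positivity
  unfold cvx
  positivity

theorem cvx_eq (hd : 2 ≤ d) (b b' : BdA d) (t t' : unitInterval)
    (he : ∀ i, cvx b t i = cvx b' t' i) : t = t' ∧ (t = 0 ∨ b = b') := by
  have aux : ∀ (b b' : BdA d) (t t' : unitInterval),
      (∀ i, cvx b t i = cvx b' t' i) → (t : ℝ) ≤ t' := by
    intro b b' t t' he
    obtain ⟨i, hi⟩ := b.2.2.2
    have h1 := he i
    have h2 : 0 ≤ (t' : ℝ) * b'.1 i := mul_nonneg t'.2.1 (b'.2.1 i)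
    have h3 : (0:ℝ) < d := by positivity
    simp only [cvx, hi, mul_zero, add_zero] at h1
    have h4 : (1 - (t' : ℝ)) / d ≤ (1 - (t : ℝ)) / d := by linarith
    rw [div_le_div_iff_of_pos_right h3] at h4
    linarith
  have ht : t = t' := Subtype.ext (le_antisymm (aux _ _ _ _ he) (aux _ _ _ _ fun i => (he i).symm))
  refine ⟨ht, ?_⟩
  subst ht
  by_cases h0 : t = 0
  · exact Or.inl h0
  · right
    have h0' : (t : ℝ) ≠ 0 := fun h => h0 (Subtype.ext h)
    refine Subtype.ext (funext fun i => ?_)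
    have := he i
    simp only [cvx, add_right_inj] at this
    exact mul_left_cancel₀ h0' this

theorem cvx_one (b : BdA d) : cvx b 1 = b.1 := by
  funext i; simp [cvx]

theorem cvx_zero (b b' : BdA d) : cvx b 0 = cvx b' 0 := by
  funext i; simp [cvx]

def PMap (hd : 2 ≤ d) (h : SplitData K v w) :
    KS K v ⊕ ((Fin N × BdA d) × unitInterval) → realization K :=
  Sum.elim (fun k => k.1)
    (fun p => RP h p.1.1 (cvx p.1.2 p.2) (cvx_nonneg _ _) (cvx_sum hd _ _))

theorem PMap_continuous (hd : 2 ≤ d) (h : SplitData K v w) : Continuous (PMap hd h) := by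
  refine continuous_sum_dom.2 ⟨continuous_subtype_val, ?_⟩
  refine cont_disc _ fun s => ?_
  refine Continuous.subtype_mk (continuous_pi fun y => ?_) _
  refine wt_continuous (v s) _ (fun i => ?_) y
  have hb : Continuous (fun p : BdA d × unitInterval => p.1.1 i) :=
    (BdA.continuous_coord d i).comp continuous_fst
  have ht : Continuous (fun p : BdA d × unitInterval => (p.2 : ℝ)) := by fun_prop
  exact ((continuous_const.sub ht).div_const _).add (ht.mul hb)

theorem PMap_surj (hd : 2 ≤ d) (h : SplitData K v w) : Function.Surjective (PMap hd h) := by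
  intro f
  by_cases hf : ∀ s, ∃ i, f.1 (v s i) = 0
  · exact ⟨Sum.inl ⟨f, hf⟩, rfl⟩
  push Not at hf
  obtain ⟨s, hs⟩ := hf
  have hsupp : ∀ y, f.1 y ≠ 0 → ∃ i, y = v s i := fun y hy =>
    h.max s _ f.2.2.2 (fun i => by simpa using hs i) y (by simpa using hy)
  have : Nonempty (Fin d) := ⟨⟨0, by omega⟩⟩
  obtain ⟨i1, hi1⟩ := Finite.exists_min (fun i => f.1 (v s i))
  have hd0 : (0:ℝ) < d := by positivity
  have hfe : f.1 = wt (v s) (fun i => f.1 (v s i)) := by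
    funext y
    by_cases hy : ∃ i, y = v s i
    · obtain ⟨i, rfl⟩ := hy
      rw [wt_inj (h.inj s)]
    · rw [wt_zero (fun i hi => absurd ⟨i, hi.symm⟩ hy)]
      by_contra hne
      exact hy (hsupp y hne)
  have hsum : ∑ i, f.1 (v s i) = 1 := by
    rw [← sum_wt (v s), ← hfe]; exact f.2.2.1
  set m := f.1 (v s i1) with hm
  have hm0 : 0 ≤ m := f.2.1 _
  have hdm : d * m ≤ 1 := by
    rw [← hsum]
    calc d * m = ∑ _i : Fin d, m := by simp
      _ ≤ _ := Finset.sum_le_sum fun i _ => hi1 i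
  by_cases h1 : d * m = 1
  · obtain ⟨b0⟩ := BdA.nonempty hd
    have hall : ∀ i, m = f.1 (v s i) := by
      have := (Finset.sum_eq_sum_iff_of_le (s := Finset.univ) (f := fun _ : Fin d => m)
        (g := fun i => f.1 (v s i)) (fun i _ => hi1 i)).1 (by rw [hsum]; simpa using h1)
      exact fun i => this i (Finset.mem_univ i)
    refine ⟨Sum.inr ((s, b0), 0), Subtype.ext ?_⟩
    change wt (v s) (cvx b0 0) = f.1
    rw [hfe]
    congr 1
    funext i
    simp only [cvx]
    rw [← hall i]
    simp
    field_simp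
    linarith
  · have hlt : 0 < 1 - d * m := by
      have := lt_of_le_of_ne hdm h1
      linarith
    refine ⟨Sum.inr ((s, ⟨fun i => (f.1 (v s i) - m) / (1 - d * m), ?_, ?_, i1, ?_⟩),
      ⟨1 - d * m, hlt.le, ?_⟩), Subtype.ext ?_⟩
    · intro i
      exact div_nonneg (sub_nonneg.2 (hi1 i)) hlt.le
    · rw [← Finset.sum_div, Finset.sum_sub_distrib, hsum]
      simp
      exact hlt.ne'
    · simp [hm]
    · have : 0 ≤ d * m := by positivity
      linarith
    · refine Eq.trans ?_ hfe.symm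
      change wt (v s) _ = _
      congr 1
      funext i
      simp only [cvx]
      field_simp
      ring

theorem PMap_attach (hd : 2 ≤ d) (h : SplitData K v w) : IsAttach (aMap h) (PMap hd h) := by
  have hval : ∀ s b t i, (PMap hd h (Sum.inr ((s, b), t))).1 (v s i) = cvx b t i :=
    fun s b t i => wt_inj (h.inj s) _ i
  have hone : ∀ x, PMap hd h (Sum.inr (x, 1)) = PMap hd h (Sum.inl (aMap h x)) := by
    rintro ⟨s, b⟩
    refine Subtype.ext ?_
    change wt (v s) (cvx b 1) = wt (v s) b.1
    rw [cvx_one]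
  refine ⟨Topology.IsQuotientMap.of_surjective_continuous (PMap_surj hd h)
    (PMap_continuous hd h), hone, ?_, ?_⟩
  · intro s b b'
    refine Subtype.ext ?_
    change wt (v s) (cvx b 0) = wt (v s) (cvx b' 0)
    rw [cvx_zero]
  · intro z z' hzz T φ h1 h0
    have hA : ∀ (k : KS K v) s b t, PMap hd h (Sum.inl k) = PMap hd h (Sum.inr ((s, b), t)) →
        φ (Sum.inl k) = φ (Sum.inr ((s, b), t)) := by
      intro k s b t he
      by_cases ht : t = 1
      · subst ht
        rw [h1]
        rw [hone] at he
        exact congrArg (fun k => φ (Sum.inl k)) (Subtype.ext he)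
      · obtain ⟨i, hi⟩ := k.2 s
        have h2 := hval s b t i
        rw [← he] at h2
        have h3 : (PMap hd h (Sum.inl k)).1 (v s i) = 0 := hi
        have := cvx_pos hd b t ht i
        rw [← h2, h3] at this
        exact absurd this (lt_irrefl _)
    rcases z with k | ⟨⟨s, b⟩, t⟩ <;> rcases z' with k' | ⟨⟨s', b'⟩, t'⟩
    · exact congrArg (fun k => φ (Sum.inl k)) (Subtype.ext hzz)
    · exact hA _ _ _ _ hzz
    · exact (hA _ _ _ _ hzz.symm).symm
    · by_cases ht : t = 1
      · subst ht
        rw [h1]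
        rw [hone] at hzz
        exact hA _ _ _ _ hzz
      by_cases ht' : t' = 1
      · subst ht'
        rw [h1]
        rw [hone] at hzz
        exact (hA _ _ _ _ hzz.symm).symm
      by_cases hs : s = s'
      · subst hs
        obtain ⟨rfl, h2⟩ := cvx_eq hd b b' t t' fun i => by
          rw [← hval s b t i, hzz, hval]
        rcases h2 with rfl | rfl
        · exact h0 _ _ _
        · rfl
      · obtain ⟨i, hi⟩ := h.dist _ _ hs
        have h2 := hval s' b' t' i
        rw [← hzz] at h2
        have h3 : (PMap hd h (Sum.inr ((s, b), t))).1 (v s' i) = 0 :=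
          wt_zero fun j hj => absurd hj.symm (hi j).1
        have := cvx_pos hd b' t' ht' i
        rw [← h2, h3] at this
        exact absurd this (lt_irrefl _)

/-! the contracting homotopy -/

def zy (b : BdA d) (t : unitInterval) (i : Fin d) : ℝ := (1 - (t : ℝ)) * b.1 i - t / d
def zv (b : BdA d) (t : unitInterval) (i : Fin d) : ℝ := max (zy b t i) 0
def zw (i0 : Fin d) (b : BdA d) (t : unitInterval) (i : Fin d) : ℝ :=
  ((1 - (t : ℝ)) + (if i = i0 then (t : ℝ) else 0)) * max (-zy b t i) 0
def zD (i0 : Fin d) (b : BdA d) (t : unitInterval) : ℝ := ∑ i, zv b t i + ∑ i, zw i0 b t i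

theorem zv_nonneg (b : BdA d) (t : unitInterval) (i : Fin d) : 0 ≤ zv b t i := le_max_right _ _

theorem zw_nonneg (i0 : Fin d) (b : BdA d) (t : unitInterval) (i : Fin d) : 0 ≤ zw i0 b t i := by
  refine mul_nonneg ?_ (le_max_right _ _)
  have := t.2.1
  have := t.2.2
  split_ifs <;> linarith

theorem zD_pos (hd : 2 ≤ d) (i0 : Fin d) (b : BdA d) (t : unitInterval) : 0 < zD i0 b t := by
  have hd0 : (0:ℝ) < d := by positivity
  have hv : 0 ≤ ∑ i, zv b t i := Finset.sum_nonneg fun i _ => zv_nonneg b t i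
  have hw : 0 ≤ ∑ i, zw i0 b t i := Finset.sum_nonneg fun i _ => zw_nonneg i0 b t i
  refine lt_of_le_of_ne (add_nonneg hv hw) fun h => ?_
  have hv0 : ∑ i, zv b t i = 0 := by unfold zD at h; linarith
  have hw0 : ∑ i, zw i0 b t i = 0 := by unfold zD at h; linarith
  have hv1 : ∀ i, zv b t i = 0 := fun i =>
    (Finset.sum_eq_zero_iff_of_nonneg fun i _ => zv_nonneg b t i).1 hv0 i (Finset.mem_univ i)
  have hw1 : ∀ i, zw i0 b t i = 0 := fun i =>
    (Finset.sum_eq_zero_iff_of_nonneg fun i _ => zw_nonneg i0 b t i).1 hw0 i (Finset.mem_univ i)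
  have ht0 := t.2.1
  have ht1 := t.2.2
  by_cases ht : (t : ℝ) = 1
  · have := hw1 i0
    simp [zw, zy, ht] at this
    omega
  · have htl : 0 < 1 - (t : ℝ) := by
      have := lt_of_le_of_ne ht1 ht
      linarith
    have hy : ∀ i, zy b t i = 0 := by
      intro i
      have h1 : zy b t i ≤ 0 := by
        have := hv1 i
        unfold zv at this
        exact max_eq_right_iff.1 this
      have h2 : max (-zy b t i) 0 = 0 := by
        have h3 := hw1 i
        unfold zw at h3
        rcases mul_eq_zero.1 h3 with h4 | h4
        · exfalso
          split_ifs at h4 <;> linarith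
        · exact h4
      have h3 := max_eq_right_iff.1 h2
      linarith
    obtain ⟨i, hi⟩ := b.2.2.2
    have h1 := hy i
    have ht' : (t : ℝ) = 0 := by
      simp [zy, hi] at h1
      rcases h1 with h1 | h1
      · simp [h1]
      · omega
    have : ∑ i, b.1 i = 0 := Finset.sum_eq_zero fun j _ => by
      have := hy j
      simpa [zy, ht'] using this
    rw [b.2.2.1] at this
    exact one_ne_zero this

theorem zy_continuous (i : Fin d) :
    Continuous (fun p : BdA d × unitInterval => zy p.1 p.2 i) := by
  have hb : Continuous (fun p : BdA d × unitInterval => p.1.1 i) :=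
    (BdA.continuous_coord d i).comp continuous_fst
  have ht : Continuous (fun p : BdA d × unitInterval => (p.2 : ℝ)) := by fun_prop
  exact ((continuous_const.sub ht).mul hb).sub (ht.div_const _)

theorem zv_continuous (i : Fin d) :
    Continuous (fun p : BdA d × unitInterval => zv p.1 p.2 i) :=
  (zy_continuous i).max continuous_const

theorem zw_continuous (i0 i : Fin d) :
    Continuous (fun p : BdA d × unitInterval => zw i0 p.1 p.2 i) := by
  unfold zw
  refine Continuous.mul ?_ ((zy_continuous i).neg.max continuous_const)
  split_ifs <;> fun_prop

theorem zD_continuous (i0 : Fin d) :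
    Continuous (fun p : BdA d × unitInterval => zD i0 p.1 p.2) := by
  unfold zD
  exact (continuous_finsetSum _ fun i _ => zv_continuous i).add
    (continuous_finsetSum _ fun i _ => zw_continuous i0 i)

def hFun (v w : Fin N → Fin d → V) (i0 : Fin d) (s : Fin N) (b : BdA d) (t : unitInterval)
    (y : V) : ℝ :=
  (wt (v s) (zv b t) y + wt (w s) (zw i0 b t) y) / zD i0 b t

theorem hFun_ne {i0 : Fin d} {s : Fin N} {b : BdA d} {t : unitInterval} {y : V}
    (h : hFun v w i0 s b t y ≠ 0) :
    ∃ i, (y = v s i ∧ 0 < zy b t i) ∨ (y = w s i ∧ zy b t i < 0) := by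
  unfold hFun at h
  have h1 : wt (v s) (zv b t) y ≠ 0 ∨ wt (w s) (zw i0 b t) y ≠ 0 := by
    by_contra hc
    push Not at hc
    rw [hc.1, hc.2] at h
    simp at h
  rcases h1 with h1 | h1
  · obtain ⟨i, hi, hz⟩ := wt_ne h1
    refine ⟨i, Or.inl ⟨hi.symm, ?_⟩⟩
    by_contra hc
    exact hz (max_eq_right (not_lt.1 hc))
  · obtain ⟨i, hi, hz⟩ := wt_ne h1
    refine ⟨i, Or.inr ⟨hi.symm, ?_⟩⟩
    by_contra hc
    apply hz
    unfold zw
    rw [max_eq_right (by linarith [not_lt.1 hc]), mul_zero]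

def HMap (hd : 2 ≤ d) (h : SplitData K v w) (i0 : Fin d) (p : (Fin N × BdA d) × unitInterval) :
    KS K v :=
  ⟨⟨hFun v w i0 p.1.1 p.1.2 p.2,
    fun y => div_nonneg (add_nonneg (wt_nonneg _ _ (zv_nonneg _ _) y)
      (wt_nonneg _ _ (zw_nonneg _ _ _) y)) (zD_pos hd _ _ _).le, by
    simp only [hFun, ← Finset.sum_div, Finset.sum_add_distrib, sum_wt]
    exact div_self (zD_pos hd _ _ _).ne', by
    refine h.choice p.1.1 (fun i => zy p.1.2 p.2 i < 0) _ fun y hy => ?_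
    obtain ⟨i, hi⟩ := hFun_ne (Finset.mem_filter.1 hy).2
    exact ⟨i, hi.imp (fun h => ⟨h.1, h.2.not_gt⟩) id⟩⟩, by
    intro s
    by_cases hs : p.1.1 = s
    · subst hs
      obtain ⟨i, hi⟩ := p.1.2.2.2.2
      refine ⟨i, ?_⟩
      by_contra hc
      obtain ⟨j, ⟨hj, hz⟩ | ⟨hj, hz⟩⟩ := hFun_ne hc
      · have := h.inj _ hj
        subst this
        have : (0:ℝ) ≤ (p.2 : ℝ) / d := div_nonneg p.2.2.1 (Nat.cast_nonneg d)
        simp only [zy, hi, mul_zero] at hz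
        linarith
      · exact h.own _ _ _ hj
    · obtain ⟨i, hi⟩ := h.dist _ _ hs
      refine ⟨i, ?_⟩
      by_contra hc
      obtain ⟨j, ⟨hj, hz⟩ | ⟨hj, hz⟩⟩ := hFun_ne hc
      · exact (hi j).1 hj
      · exact (hi j).2 hj⟩

theorem HMap_continuous (hd : 2 ≤ d) (h : SplitData K v w) (i0 : Fin d) :
    Continuous (HMap hd h i0) := by
  refine cont_disc _ fun s => ?_
  refine Continuous.subtype_mk (Continuous.subtype_mk (continuous_pi fun y => ?_) _) _
  exact ((wt_continuous (v s) (fun p : BdA d × unitInterval => zv p.1 p.2) zv_continuous y).add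
    (wt_continuous (w s) (fun p : BdA d × unitInterval => zw i0 p.1 p.2) (zw_continuous i0) y)).div
    (zD_continuous i0) (fun p => (zD_pos hd _ _ _).ne')

theorem HMap_zero (hd : 2 ≤ d) (h : SplitData K v w) (i0 : Fin d) (x : Fin N × BdA d) :
    HMap hd h i0 (x, 0) = aMap h x := by
  obtain ⟨s, b⟩ := x
  have h1 : zv b 0 = b.1 := by
    funext i; simp [zv, zy, b.2.1 i]
  have h2 : zw i0 b 0 = 0 := by
    funext i; simp [zw, zy, b.2.1 i]
  have h3 : zD i0 b 0 = 1 := by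
    unfold zD; rw [h1, h2, b.2.2.1]; simp
  refine Subtype.ext (Subtype.ext (funext fun y => ?_))
  change hFun v w i0 s b 0 y = wt (v s) b.1 y
  unfold hFun
  rw [h1, h2, h3, div_one, wt_zero (u := w s) (x := 0) (fun _ _ => rfl), add_zero]

theorem hFun_one (hd : 2 ≤ d) (i0 : Fin d) (s : Fin N) (b : BdA d) (y : V) :
    hFun v w i0 s b 1 y = if w s i0 = y then 1 else 0 := by
  have hd0 : (d : ℝ) ≠ 0 := by positivity
  have h1 : zv b 1 = 0 := by
    funext i; simp [zv, zy]
  have h2 : ∀ i, zw i0 b 1 i = if i = i0 then (1 / d : ℝ) else 0 := by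
    intro i; simp [zw, zy]
  have h3 : zD i0 b 1 = 1 / d := by
    unfold zD; rw [h1]; simp [h2]
  unfold hFun
  rw [h1, h3, wt_zero (u := v s) (x := 0) (fun _ _ => rfl), zero_add]
  unfold wt
  rw [Finset.sum_eq_single i0]
  · rw [h2, if_pos rfl]
    split_ifs <;> simp [hd0]
  · intro j _ hj
    rw [h2, if_neg hj]; simp
  · simp

theorem split_main (hd : 2 ≤ d) (s0 : Fin N) (h : SplitData K v w) (i0 : Fin d) (w0 : V)
    (hw : ∀ s, w s i0 = w0) :
    ∃ (X : Type) (_ : TopologicalSpace X) (x0 : X)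
      (pt : Fin N → Metric.sphere (0 : EuclideanSpace ℝ (Fin d)) 1)
      (w0 : PtdWedge (fun _ : Fin N => Metric.sphere (0 : EuclideanSpace ℝ (Fin d)) 1) pt),
      Nonempty (ContinuousMap.HomotopyEquiv (realization K)
        (Wedge2 (PtdWedge (fun _ : Fin N => Metric.sphere (0 : EuclideanSpace ℝ (Fin d)) 1) pt)
          X w0 x0)) := by
  obtain ⟨b0⟩ := BdA.nonempty hd
  obtain ⟨pt, q0, P, hP⟩ := wedge_attach hd s0 (HMap hd h i0 ((s0, b0), 1))
  refine ⟨KS K v, inferInstance, HMap hd h i0 ((s0, b0), 1), pt, q0, ?_⟩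
  refine attach_equiv (PMap_attach hd h) hP (HMap_continuous hd h i0) (HMap_zero hd h i0) ?_
  rintro ⟨s, b⟩
  refine Subtype.ext (Subtype.ext (funext fun y => ?_))
  change hFun v w i0 s b 1 y = hFun v w i0 s0 b0 1 y
  rw [hFun_one hd, hFun_one hd, hw, hw]

end RealAttach

/-! the local combinatorics of a tile -/

theorem all_fin {n : ℕ} {f : Fin n → Bool} (h : (List.finRange n).all f = true) (i : Fin n) :
    f i = true := (List.all_eq_true.1 h) i (List.mem_finRange i)

def allB (f : Bool → Bool) : Bool := f true && f false

theorem all_bool {f : Bool → Bool} (h : allB f = true) (b : Bool) : f b = true := by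
  unfold allB at h
  rw [Bool.and_eq_true] at h
  cases b
  · exact h.2
  · exact h.1

def feq (x y : Fin 6) : Bool := Nat.beq x.1 y.1

theorem feq_iff {x y : Fin 6} : feq x y = true ↔ x = y := by
  unfold feq; rw [Nat.beq_eq, Fin.ext_iff]

/-- labels of arcs within a cell -/
def lS (l l' : Fin 6) : Bool :=
  match l.1, l'.1 with
  | 0, 1 => true | 3, 4 => true | 2, 0 => true | 2, 1 => true | 2, 3 => true | 2, 4 => true
  | 5, 4 => true | _, _ => false

/-- labels of arcs to the cell on the right -/
def lR (l l' : Fin 6) : Bool :=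
  match l.1, l'.1 with
  | 1, 0 => true | 4, 3 => true | 5, 3 => true | _, _ => false

def S0 (c l c' l' : Fin 6) : Bool :=
  (lS l l' && feq c' c) || (lR l l' && !(feq c 5) && Nat.beq c'.1 (c.1 + 1))

def X0 (c l c' l' : Fin 6) : Bool :=
  (lR l l' && feq c 5 && feq c' 0) ||
  (feq l 5 && feq l' 1 && Nat.beq c'.1 ((c.1 + 3) % 6)) ||
  (feq l 5 && feq l' 0 && Nat.beq c'.1 ((c.1 + 4) % 6))

def SS (p p' : Fin 6 × Fin 6) : Bool := S0 p.1 p.2 p'.1 p'.2 || S0 p'.1 p'.2 p.1 p.2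
def XX (p p' : Fin 6 × Fin 6) : Bool := X0 p.1 p.2 p'.1 p'.2 || X0 p'.1 p'.2 p.1 p.2

/-- the two configurations; third argument `false`: transversal, `true`: partner -/
def tp (β : Bool) (e : Fin 8) (p : Bool) : Fin 6 × Fin 6 :=
  match e.1, β, p with
  | 0, true, false => (0, 2)
  | 0, true, true => (0, 4)
  | 1, true, false => (1, 2)
  | 1, true, true => (1, 0)
  | 0, false, false => (0, 1)
  | 0, false, true => (1, 0)
  | 1, false, false => (1, 3)
  | 1, false, true => (0, 4)
  | 2, _, false => (2, 0)
  | 2, _, true => (2, 1)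
  | 3, _, false => (2, 4)
  | 3, _, true => (2, 3)
  | 4, _, false => (3, 1)
  | 4, _, true => (3, 2)
  | 5, _, false => (4, 3)
  | 5, _, true => (4, 2)
  | 6, _, false => (5, 0)
  | 6, _, true => (5, 1)
  | _, _, false => (5, 4)
  | _, _, true => (5, 3)

def peq (p p' : Fin 6 × Fin 6) : Bool := feq p.1 p'.1 && feq p.2 p'.2

theorem peq_iff {p p' : Fin 6 × Fin 6} : peq p p' = true ↔ p = p' := by
  unfold peq; rw [Bool.and_eq_true, feq_iff, feq_iff, Prod.ext_iff]

def chkS : Bool :=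
  allB fun β => (List.finRange 8).all fun e =>
  (List.finRange 8).all fun e' => allB fun p =>
  allB fun p' =>
    !(SS (tp β e p) (tp β e' p')) || (Nat.beq e.1 e'.1 && (xor p p'))

def chkX : Bool :=
  allB fun β =>
  allB fun β' => (List.finRange 8).all fun e =>
  (List.finRange 8).all fun e' => allB fun p =>
  allB fun p' =>
    !(XX (tp β e p) (tp β' e' p'))

def chkD : Bool :=
  allB fun β =>
  (List.finRange 6).all fun c => (List.finRange 6).all fun l =>
    (List.finRange 8).any fun e => peq (tp β e false) (c, l) || SS (c, l) (tp β e false) ||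
      (peq (tp true e false) (tp false e false) && XX (c, l) (tp true e false))

def chkN : Bool :=
  allB fun β =>
  (List.finRange 8).any fun e => (List.finRange 8).all fun e' =>
  allB fun p => !(peq (tp (!β) e false) (tp β e' p))

def chkI : Bool :=
  allB fun β =>
  (List.finRange 8).all fun e => (List.finRange 8).all fun e' =>
  (!(peq (tp β e false) (tp β e' false)) || Nat.beq e.1 e'.1) &&
    !(peq (tp β e false) (tp β e' true))

set_option maxRecDepth 100000 in
theorem chkS_true : chkS = true := by rfl
set_option maxRecDepth 100000 in
theorem chkX_true : chkX = true := by rfl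
set_option maxRecDepth 100000 in
theorem chkD_true : chkD = true := by rfl
set_option maxRecDepth 100000 in
theorem chkN_true : chkN = true := by rfl
set_option maxRecDepth 100000 in
theorem chkI_true : chkI = true := by rfl

theorem tpS (β : Bool) (e e' : Fin 8) (p p' : Bool) (h : SS (tp β e p) (tp β e' p') = true) :
    e = e' ∧ p ≠ p' := by
  have h0 := chkS_true
  unfold chkS at h0
  have := all_bool (all_bool (all_fin (all_fin (all_bool h0 β) e) e') p) p'
  rw [h] at this
  simp only [Bool.not_true, Bool.false_or, Bool.and_eq_true, Nat.beq_eq] at this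
  refine ⟨Fin.ext this.1, ?_⟩
  rintro rfl
  simp at this

theorem tpX (β β' : Bool) (e e' : Fin 8) (p p' : Bool) : XX (tp β e p) (tp β' e' p') = false := by
  have h0 := chkX_true
  unfold chkX at h0
  have := all_bool (all_bool (all_fin (all_fin (all_bool (all_bool h0 β) β') e) e') p) p'
  simpa using this

theorem tpD (β : Bool) (c l : Fin 6) : ∃ e, tp β e false = (c, l) ∨
    SS (c, l) (tp β e false) = true ∨
    (tp true e false = tp false e false ∧ XX (c, l) (tp true e false) = true) := by
  have h0 := chkD_true
  unfold chkD at h0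
  have := all_fin (all_fin (all_bool h0 β) c) l
  obtain ⟨e, -, he⟩ := List.any_eq_true.1 this
  rw [Bool.or_eq_true, Bool.or_eq_true, Bool.and_eq_true, peq_iff, peq_iff, or_assoc] at he
  exact ⟨e, he⟩

theorem tpN (β : Bool) : ∃ e, ∀ e' p, tp (!β) e false ≠ tp β e' p := by
  have h0 := chkN_true
  unfold chkN at h0
  have := all_bool h0 β
  obtain ⟨e, -, he⟩ := List.any_eq_true.1 this
  refine ⟨e, fun e' p h => ?_⟩
  have h2 := all_bool (all_fin he e') p
  rw [peq_iff.2 h] at h2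
  simp at h2

theorem tpI (β : Bool) (e e' : Fin 8) :
    (tp β e false = tp β e' false → e = e') ∧ tp β e false ≠ tp β e' true := by
  have h0 := chkI_true
  unfold chkI at h0
  have := all_fin (all_fin (all_bool h0 β) e) e'
  rw [Bool.and_eq_true] at this
  refine ⟨fun h => ?_, fun h => ?_⟩
  · have h2 := this.1
    rw [peq_iff.2 h] at h2
    simp only [Bool.not_true, Bool.false_or, Nat.beq_eq] at h2
    exact Fin.ext h2
  · have h2 := this.2
    rw [peq_iff.2 h] at h2
    simp at h2

section Geometry

variable {a q : ℕ}

theorem finSucc_cases {N : ℕ} {i i' : Fin N} (h : finSucc i i') :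
    ((i : ℕ) + 1 < N ∧ (i' : ℕ) = i + 1) ∨ ((i : ℕ) + 1 = N ∧ (i' : ℕ) = 0) := by
  unfold finSucc at h
  have := i.2
  rcases Nat.lt_or_ge ((i : ℕ) + 1) N with h1 | h1
  · left; rw [Nat.mod_eq_of_lt h1] at h; exact ⟨h1, h⟩
  · right
    have h2 : (i : ℕ) + 1 = N := by omega
    rw [h2, Nat.mod_self] at h
    exact ⟨h2, h⟩

theorem finSucc_exists {N : ℕ} (i : Fin N) : ∃ i', finSucc i i' :=
  ⟨⟨((i : ℕ) + 1) % N, Nat.mod_lt _ (by have := i.2; omega)⟩, rfl⟩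

theorem finPred_exists {N : ℕ} (i' : Fin N) : ∃ i, finSucc i i' := by
  have := i'.2
  rcases Nat.eq_zero_or_pos (i' : ℕ) with h | h
  · refine ⟨⟨N - 1, by omega⟩, ?_⟩
    unfold finSucc
    have h2 : N - 1 + 1 = N := by omega
    simp only [h2, Nat.mod_self]
    exact h
  · refine ⟨⟨(i' : ℕ) - 1, by omega⟩, ?_⟩
    unfold finSucc
    have h2 : (i' : ℕ) - 1 + 1 = i' := by omega
    simp only [h2]
    exact (Nat.mod_eq_of_lt i'.2).symm

def xpos (z : Fin (6 * a) × Fin q) : ℕ :=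
  if z.2.1 % 2 = 0 then z.1.1 else if 3 ≤ z.1.1 then z.1.1 - 3 else z.1.1 + 6 * a - 3

theorem xpos_lt (z : Fin (6 * a) × Fin q) : xpos z < 6 * a := by
  have := z.1.2
  unfold xpos
  split_ifs <;> omega

def tile (z : Fin (6 * a) × Fin q) : Fin a × Fin q :=
  (⟨xpos z / 6, by have := xpos_lt z; omega⟩, z.2)

def cls (z : Fin (6 * a) × Fin q) : Fin 6 := ⟨xpos z % 6, by omega⟩

def enc (t : Fin a × Fin q) (c : Fin 6) : Fin (6 * a) × Fin q :=
  (⟨if t.2.1 % 2 = 0 then 6 * t.1.1 + c.1 else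
    if 6 * t.1.1 + c.1 + 3 < 6 * a then 6 * t.1.1 + c.1 + 3 else 6 * t.1.1 + c.1 + 3 - 6 * a, by
    have := t.1.2
    have := c.2
    split_ifs <;> omega⟩, t.2)

theorem xpos_enc (t : Fin a × Fin q) (c : Fin 6) : xpos (enc t c) = 6 * t.1.1 + c.1 := by
  have := t.1.2
  have := c.2
  unfold xpos enc
  simp only
  split_ifs <;> omega

theorem tile_enc (t : Fin a × Fin q) (c : Fin 6) : tile (enc t c) = t := by
  refine Prod.ext (Fin.ext ?_) rfl
  have := c.2
  simp only [tile, xpos_enc]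
  omega

theorem cls_enc (t : Fin a × Fin q) (c : Fin 6) : cls (enc t c) = c := by
  refine Fin.ext ?_
  have := c.2
  simp only [cls, xpos_enc]
  omega

theorem enc_tile (z : Fin (6 * a) × Fin q) : enc (tile z) (cls z) = z := by
  refine Prod.ext (Fin.ext ?_) rfl
  have h1 := xpos_lt z
  have h2 := z.1.2
  have h3 : 6 * (xpos z / 6) + xpos z % 6 = xpos z := by omega
  simp only [enc, tile, cls, h3]
  unfold xpos at *
  split_ifs at * <;> omega

theorem xpos_right {z z' : Fin (6 * a) × Fin q} (h : finSucc z.1 z'.1) (h2 : z'.2 = z.2) :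
    (xpos z + 1 < 6 * a ∧ xpos z' = xpos z + 1) ∨ (xpos z + 1 = 6 * a ∧ xpos z' = 0) := by
  have h3 := z.1.2
  have h4 := z'.1.2
  have := finSucc_cases h
  unfold xpos
  rw [h2]
  split_ifs <;> omega

theorem cls_right {z z' : Fin (6 * a) × Fin q} (h : finSucc z.1 z'.1) (h2 : z'.2 = z.2) :
    (cls z').1 = ((cls z).1 + 1) % 6 := by
  have := xpos_right h h2
  simp only [cls]
  omega

theorem tile_right {z z' : Fin (6 * a) × Fin q} (h : finSucc z.1 z'.1) (h2 : z'.2 = z.2)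
    (hc : cls z ≠ 5) : tile z' = tile z := by
  have h3 := xpos_right h h2
  have h4 : xpos z % 6 ≠ 5 := fun h => hc (Fin.ext h)
  refine Prod.ext (Fin.ext ?_) h2
  simp only [tile]
  omega

theorem cls_up (hq : q % 2 = 0) {z z' : Fin (6 * a) × Fin q} (h : finSucc z.2 z'.2)
    (h2 : z'.1 = z.1) : (cls z').1 = ((cls z).1 + 3) % 6 := by
  have h3 := finSucc_cases h
  have h4 := z.1.2
  simp only [cls, xpos]
  rw [h2]
  split_ifs <;> omega

theorem cls_upright (hq : q % 2 = 0) {z z' : Fin (6 * a) × Fin q} (h : finSucc z.1 z'.1)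
    (h2 : finSucc z.2 z'.2) : (cls z').1 = ((cls z).1 + 4) % 6 := by
  have h3 := cls_right (z := z) (z' := (z'.1, z.2)) h rfl
  have h4 := cls_up hq (z := (z'.1, z.2)) (z' := z') h2 rfl
  omega

theorem rel_local (hq : q % 2 = 0) {x y : (Fin (6 * a) × Fin q) × Fin 6}
    (h : kagomeRel (6 * a) q x y) :
    (tile y.1 = tile x.1 ∧ S0 (cls x.1) x.2 (cls y.1) y.2 = true) ∨
      X0 (cls x.1) x.2 (cls y.1) y.2 = true := by
  have hsame : lS x.2 y.2 = true → y.1 = x.1 →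
      (tile y.1 = tile x.1 ∧ S0 (cls x.1) x.2 (cls y.1) y.2 = true) := by
    intro h1 h2
    rw [h2]
    refine ⟨rfl, ?_⟩
    simp [S0, h1, feq_iff.2 rfl]
  have hright : lR x.2 y.2 = true → finSucc x.1.1 y.1.1 → y.1.2 = x.1.2 →
      (tile y.1 = tile x.1 ∧ S0 (cls x.1) x.2 (cls y.1) y.2 = true) ∨
      X0 (cls x.1) x.2 (cls y.1) y.2 = true := by
    intro h1 h2 h3
    have hc := cls_right h2 h3
    by_cases h5 : cls x.1 = 5
    · right
      have h6 : cls y.1 = 0 := by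
        refine Fin.ext ?_
        rw [hc, h5]
        rfl
      simp [X0, h1, h5, h6, feq_iff.2 rfl]
    · left
      refine ⟨tile_right h2 h3 h5, ?_⟩
      have h6 : (cls y.1).1 = (cls x.1).1 + 1 := by
        have h7 := (cls x.1).2
        have h8 : (cls x.1).1 ≠ 5 := fun h => h5 (Fin.ext h)
        omega
      have h7 : feq (cls x.1) 5 = false := by
        rw [← Bool.not_eq_true, feq_iff]; exact h5
      unfold S0
      rw [h1, h7, h6]
      simp
  unfold kagomeRel at h
  rcases h with ⟨h1, h2, h3⟩ | ⟨h1, h2, h3, h4⟩ | ⟨h1, h2, h3⟩ | ⟨h1, h2, h3, h4⟩ |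
    ⟨h1, h2, h3⟩ | ⟨h1, ⟨h2, h3⟩ | ⟨h2, h3, h4⟩ | ⟨h2, h3, h4⟩ | ⟨h2, h3, h4⟩⟩
  · left; apply hsame _ h3; rw [h1, h2]; rfl
  · apply hright _ h3 h4; rw [h1, h2]; rfl
  · left; apply hsame _ h3; rw [h1, h2]; rfl
  · apply hright _ h3 h4; rw [h1, h2]; rfl
  · left; apply hsame _ h3; rw [h1]
    rcases h2 with h2 | h2 | h2 | h2 <;> rw [h2] <;> rfl
  · left; apply hsame _ h3; rw [h1, h2]; rfl
  · apply hright _ h3 h4; rw [h1, h2]; rfl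
  · right
    unfold X0
    rw [h1, h2, cls_up hq h4 h3, feq_iff.2 rfl, feq_iff.2 rfl]
    simp
  · right
    unfold X0
    rw [h1, h2, cls_upright hq h3 h4, feq_iff.2 rfl, feq_iff.2 rfl]
    simp

theorem lS_rel {z : Fin (6 * a) × Fin q} {l l' : Fin 6} (h : lS l l' = true) :
    kagomeRel (6 * a) q (z, l) (z, l') := by
  unfold kagomeRel
  fin_cases l <;> fin_cases l' <;> simp_all [lS]

theorem lR_rel {z z' : Fin (6 * a) × Fin q} {l l' : Fin 6} (h : lR l l' = true)
    (h1 : finSucc z.1 z'.1) (h2 : z'.2 = z.2) :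
    kagomeRel (6 * a) q (z, l) (z', l') := by
  unfold kagomeRel
  fin_cases l <;> fin_cases l' <;> simp_all [lR]

theorem rel_ne {x y : (Fin (6 * a) × Fin q) × Fin 6} (h : kagomeRel (6 * a) q x y) : x ≠ y := by
  rintro rfl
  obtain ⟨z, l⟩ := x
  unfold kagomeRel at h
  simp only at h
  fin_cases l <;> simp at h

theorem adj_of_rel {x y : (Fin (6 * a) × Fin q) × Fin 6} (h : kagomeRel (6 * a) q x y) :
    (kagomeAux (6 * a) q).Adj x y := by
  unfold kagomeAux
  rw [SimpleGraph.fromRel_adj]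
  exact ⟨rel_ne h, Or.inl h⟩

theorem S0_rel {t : Fin a × Fin q} {c l c' l' : Fin 6} (h : S0 c l c' l' = true) :
    kagomeRel (6 * a) q (enc t c, l) (enc t c', l') := by
  unfold S0 at h
  rw [Bool.or_eq_true, Bool.and_eq_true, Bool.and_eq_true, Bool.and_eq_true, feq_iff,
    Nat.beq_eq] at h
  rcases h with ⟨h1, rfl⟩ | ⟨⟨h1, h2⟩, h3⟩
  · exact lS_rel h1
  · have hc : c ≠ 5 := by
      rintro rfl
      rw [feq_iff.2 rfl] at h2
      simp at h2
    obtain ⟨i', hi'⟩ := finSucc_exists (enc t c).1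
    have e1 := cls_right (z := enc t c) (z' := (i', t.2)) hi' rfl
    have e2 := tile_right (z := enc t c) (z' := (i', t.2)) hi' rfl (by rwa [cls_enc])
    rw [cls_enc] at e1
    rw [tile_enc] at e2
    have e3 : cls (i', t.2) = c' := by
      refine Fin.ext ?_
      rw [e1, h3]
      have := c'.2
      omega
    have e4 := enc_tile (i', t.2)
    rw [e2, e3] at e4
    rw [e4]
    exact lR_rel h1 hi' rfl

theorem X0_rel (hq : q % 2 = 0) {c l c' l' : Fin 6} (h : X0 c l c' l' = true) :
    (∀ t : Fin a × Fin q, ∃ t', kagomeRel (6 * a) q (enc t c, l) (enc t' c', l')) ∧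
    (∀ t' : Fin a × Fin q, ∃ t, kagomeRel (6 * a) q (enc t c, l) (enc t' c', l')) := by
  have fwd : ∀ {z z' : Fin (6 * a) × Fin q} {t}, z = enc t c → cls z' = c' →
      kagomeRel (6 * a) q (z, l) (z', l') →
      ∃ t', kagomeRel (6 * a) q (enc t c, l) (enc t' c', l') := by
    rintro z z' t rfl rfl hr
    exact ⟨tile z', by rwa [enc_tile]⟩
  have bwd : ∀ {z z' : Fin (6 * a) × Fin q} {t'}, z' = enc t' c' → cls z = c →
      kagomeRel (6 * a) q (z, l) (z', l') →
      ∃ t, kagomeRel (6 * a) q (enc t c, l) (enc t' c', l') := by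
    rintro z z' t rfl rfl hr
    exact ⟨tile z, by rwa [enc_tile]⟩
  unfold X0 at h
  simp only [Bool.or_eq_true, Bool.and_eq_true, feq_iff, Nat.beq_eq] at h
  have hc2 := c.2
  have hc2' := c'.2
  rcases h with (⟨⟨h1, rfl⟩, rfl⟩ | ⟨⟨rfl, rfl⟩, h3⟩) | ⟨⟨rfl, rfl⟩, h3⟩
  · constructor
    · intro t
      obtain ⟨i', hi'⟩ := finSucc_exists (enc t 5).1
      have e1 := cls_right (z := enc t 5) (z' := (i', t.2)) hi' rfl
      rw [cls_enc] at e1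
      exact fwd (z' := (i', t.2)) rfl (Fin.ext e1) (lR_rel h1 hi' rfl)
    · intro t'
      obtain ⟨i, hi⟩ := finPred_exists (enc t' 0).1
      have e1 := cls_right (z := (i, t'.2)) (z' := enc t' 0) hi rfl
      rw [cls_enc] at e1
      refine bwd (z := (i, t'.2)) rfl (Fin.ext ?_) (lR_rel h1 hi rfl)
      have := (cls (i, t'.2)).2
      simp at e1 ⊢
      omega
  · constructor
    · intro t
      obtain ⟨j', hj'⟩ := finSucc_exists (enc t c).2
      have e1 := cls_up hq (z := enc t c) (z' := ((enc t c).1, j')) hj' rfl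
      rw [cls_enc] at e1
      refine fwd (z' := ((enc t c).1, j')) rfl (Fin.ext (by rw [e1, h3])) ?_
      unfold kagomeRel
      simp [hj']
    · intro t'
      obtain ⟨j, hj⟩ := finPred_exists (enc t' c').2
      have e1 := cls_up hq (z := ((enc t' c').1, j)) (z' := enc t' c') hj rfl
      rw [cls_enc] at e1
      refine bwd (z := ((enc t' c').1, j)) rfl (Fin.ext ?_) ?_
      · have := (cls ((enc t' c').1, j)).2
        omega
      · unfold kagomeRel
        simp [hj]
  · constructor
    · intro t
      obtain ⟨i', hi'⟩ := finSucc_exists (enc t c).1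
      obtain ⟨j', hj'⟩ := finSucc_exists (enc t c).2
      have e1 := cls_upright hq (z := enc t c) (z' := (i', j')) hi' hj'
      rw [cls_enc] at e1
      refine fwd (z' := (i', j')) rfl (Fin.ext (by rw [e1, h3])) ?_
      unfold kagomeRel
      simp [hi', hj']
    · intro t'
      obtain ⟨i, hi⟩ := finPred_exists (enc t' c').1
      obtain ⟨j, hj⟩ := finPred_exists (enc t' c').2
      have e1 := cls_upright hq (z := (i, j)) (z' := enc t' c') hi hj
      rw [cls_enc] at e1
      refine bwd (z := (i, j)) rfl (Fin.ext ?_) ?_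
      · have := (cls (i, j)).2
        omega
      · unfold kagomeRel
        simp [hi, hj]

/-- vertex of tile `t` with given local coordinates -/
def vx (t : Fin a × Fin q) (p : Fin 6 × Fin 6) : (Fin (6 * a) × Fin q) × Fin 6 :=
  (enc t p.1, p.2)

theorem vx_inj {t t' : Fin a × Fin q} {p p' : Fin 6 × Fin 6} (h : vx t p = vx t' p') :
    t = t' ∧ p = p' := by
  have h1 : enc t p.1 = enc t' p'.1 := congrArg Prod.fst h
  have h2 : p.2 = p'.2 := congrArg (fun x => x.2) h
  have h3 := congrArg tile h1
  have h4 := congrArg cls h1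
  rw [tile_enc, tile_enc] at h3
  rw [cls_enc, cls_enc] at h4
  exact ⟨h3, Prod.ext h4 h2⟩

theorem vx_surj (x : (Fin (6 * a) × Fin q) × Fin 6) : ∃ t c l, x = vx t (c, l) :=
  ⟨tile x.1, cls x.1, x.2, Prod.ext (enc_tile x.1).symm rfl⟩

theorem adj_vx (hq : q % 2 = 0) {t t' : Fin a × Fin q} {p p' : Fin 6 × Fin 6}
    (h : (kagomeAux (6 * a) q).Adj (vx t p) (vx t' p')) :
    (t = t' ∧ SS p p' = true) ∨ XX p p' = true := by
  unfold kagomeAux at h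
  rw [SimpleGraph.fromRel_adj] at h
  unfold SS XX
  rcases h.2 with h | h
  · have := rel_local hq h
    simp only [vx, tile_enc, cls_enc] at this
    rcases this with ⟨h1, h2⟩ | h2
    · left; exact ⟨h1.symm, by rw [h2]; rfl⟩
    · right; rw [h2]; rfl
  · have := rel_local hq h
    simp only [vx, tile_enc, cls_enc] at this
    rcases this with ⟨h1, h2⟩ | h2
    · left; exact ⟨h1, by rw [h2, Bool.or_true]⟩
    · right; rw [h2, Bool.or_true]

theorem SS_adj {t : Fin a × Fin q} {p p' : Fin 6 × Fin 6} (h : SS p p' = true) :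
    (kagomeAux (6 * a) q).Adj (vx t p) (vx t p') := by
  unfold SS at h
  rw [Bool.or_eq_true] at h
  rcases h with h | h
  · exact adj_of_rel (S0_rel h)
  · exact (adj_of_rel (S0_rel h)).symm

theorem XX_adj (hq : q % 2 = 0) (t : Fin a × Fin q) {p p' : Fin 6 × Fin 6} (h : XX p p' = true) :
    ∃ t', (kagomeAux (6 * a) q).Adj (vx t p) (vx t' p') := by
  unfold XX at h
  rw [Bool.or_eq_true] at h
  rcases h with h | h
  · obtain ⟨t', h'⟩ := (X0_rel hq h).1 t
    exact ⟨t', adj_of_rel h'⟩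
  · obtain ⟨t', h'⟩ := (X0_rel hq h).2 t
    exact ⟨t', (adj_of_rel h').symm⟩

theorem split_kagome (hq : q % 2 = 0) {N d : ℕ} (es : Fin N ≃ (Fin a × Fin q → Bool))
    (ed : Fin d ≃ (Fin a × Fin q) × Fin 8) :
    SplitData (indepComplex (kagomeAux (6 * a) q))
      (fun s i => vx (ed i).1 (tp (es s (ed i).1) (ed i).2 false))
      (fun s i => vx (ed i).1 (tp (es s (ed i).1) (ed i).2 true)) := by
  have hind : ∀ (s : Fin N) (i i' : Fin d) (p p' : Bool),
      (kagomeAux (6 * a) q).Adj (vx (ed i).1 (tp (es s (ed i).1) (ed i).2 p))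
        (vx (ed i').1 (tp (es s (ed i').1) (ed i').2 p')) → i = i' ∧ p ≠ p' := by
    intro s i i' p p' h
    rcases adj_vx hq h with ⟨h1, h2⟩ | h2
    · rw [← h1] at h2
      obtain ⟨h3, h4⟩ := tpS _ _ _ _ _ h2
      exact ⟨ed.injective (Prod.ext h1 h3), h4⟩
    · rw [tpX] at h2
      exact absurd h2 (by simp)
  refine ⟨?_, ?_, ?_, ?_, ?_⟩
  · intro s i i' h
    obtain ⟨h1, h2⟩ := vx_inj h
    rw [← h1] at h2
    exact ed.injective (Prod.ext h1 ((tpI _ _ _).1 h2))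
  · intro s f hf hall y hy
    have hind2 : ∀ v ∈ f, ∀ w ∈ f, ¬ (kagomeAux (6 * a) q).Adj v w := hf
    have hall' : ∀ t e, vx t (tp (es s t) e false) ∈ f := by
      intro t e
      have := hall (ed.symm (t, e))
      simpa using this
    obtain ⟨t, c, l, rfl⟩ := vx_surj y
    obtain ⟨e, h1 | h1 | ⟨h1, h2⟩⟩ := tpD (es s t) c l
    · refine ⟨ed.symm (t, e), ?_⟩
      simp [h1]
    · exact absurd (SS_adj h1) (hind2 _ hy _ (hall' t e))
    · obtain ⟨t', h3⟩ := XX_adj hq t h2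
      have h4 : tp true e false = tp (es s t') e false := by
        cases es s t'
        · exact h1
        · rfl
      rw [h4] at h3
      exact absurd h3 (hind2 _ hy _ (hall' t' e))
  · intro s c f hf
    change ∀ v ∈ f, ∀ w ∈ f, ¬ (kagomeAux (6 * a) q).Adj v w
    intro y hy y' hy' hadj
    obtain ⟨i, ⟨rfl, hi⟩ | ⟨rfl, hi⟩⟩ := hf y hy <;>
    obtain ⟨i', ⟨rfl, hi'⟩ | ⟨rfl, hi'⟩⟩ := hf y' hy' <;>
    obtain ⟨rfl, h2⟩ := hind s i i' _ _ hadj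
    · exact h2 rfl
    · exact hi hi'
    · exact hi' hi
    · exact h2 rfl
  · intro s s' hss
    have : ∃ t, es s t ≠ es s' t := by
      by_contra hc
      push Not at hc
      exact hss (es.injective (funext hc))
    obtain ⟨t, ht⟩ := this
    have ht' : es s' t = !(es s t) := by
      cases h1 : es s t <;> cases h2 : es s' t <;> simp_all
    obtain ⟨e, he⟩ := tpN (es s t)
    have key : ∀ j p, vx (ed (ed.symm (t, e))).1
        (tp (es s' (ed (ed.symm (t, e))).1) (ed (ed.symm (t, e))).2 false) ≠
        vx (ed j).1 (tp (es s (ed j).1) (ed j).2 p) := by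
      intro j p h
      rw [Equiv.apply_symm_apply] at h
      obtain ⟨h1, h2⟩ := vx_inj h
      simp only at h1 h2
      rw [← h1, ht'] at h2
      exact he _ _ h2
    exact ⟨ed.symm (t, e), fun j => ⟨key j false, key j true⟩⟩
  · intro s i j h
    obtain ⟨h1, h2⟩ := vx_inj h
    rw [← h1] at h2
    exact (tpI _ _ _).2 h2

end Geometry

/-- For a finite quotient `ℍ = ℍ_{n,m}` of the Kagome lattice tiled by
`k = v(ℍ)/36` large hexagonal tiles (`6 ∣ n`, `4 ∣ m`), there is a homotopy equivalence
`I(ℍ) ≃ (⋁_{2^k} S^{8k-1}) ∨ X` for some space `X`: the independence complex splits off a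
wedge of `2^{v(ℍ)/36}` spheres of dimension `2·v(ℍ)/9 - 1 = 8k - 1`. -/
theorem statement12 (n m : ℕ) (hn : 0 < n) (hm : 0 < m) (h6 : 6 ∣ n) (h4 : 4 ∣ m) :
    ∃ (X : Type) (_ : TopologicalSpace X) (x0 : X)
      (pt : Fin (2 ^ (3 * n * m / 36)) →
        Metric.sphere (0 : EuclideanSpace ℝ (Fin (8 * (3 * n * m / 36)))) 1)
      (w0 : PtdWedge (fun _ : Fin (2 ^ (3 * n * m / 36)) =>
        Metric.sphere (0 : EuclideanSpace ℝ (Fin (8 * (3 * n * m / 36)))) 1) pt),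
      Nonempty (ContinuousMap.HomotopyEquiv
        (realization (indepComplex (kagomeGraph n m)))
        (Wedge2 (PtdWedge (fun _ : Fin (2 ^ (3 * n * m / 36)) =>
          Metric.sphere (0 : EuclideanSpace ℝ (Fin (8 * (3 * n * m / 36)))) 1) pt)
          X w0 x0)) := by
  obtain ⟨a, rfl⟩ := h6
  obtain ⟨b, rfl⟩ := h4
  have ha : 0 < a := by omega
  have hb : 0 < b := by omega
  have hk : 3 * (6 * a) * (4 * b) / 36 = a * (4 * b / 2) := by
    have h1 : 4 * b / 2 = 2 * b := by omega
    rw [h1]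
    have h2 : 3 * (6 * a) * (4 * b) = 36 * (a * (2 * b)) := by ring
    rw [h2]
    exact Nat.mul_div_cancel_left _ (by norm_num)
  have hq : (4 * b / 2) % 2 = 0 := by omega
  have hq0 : 0 < 4 * b / 2 := by omega
  have hkpos : 0 < 3 * (6 * a) * (4 * b) / 36 := by
    rw [hk]; positivity
  generalize 3 * (6 * a) * (4 * b) / 36 = k at hk hkpos
  unfold kagomeGraph
  generalize 4 * b / 2 = q at *
  have es : Fin (2 ^ k) ≃ (Fin a × Fin q → Bool) :=
    (Fintype.equivFinOfCardEq (by simp [hk])).symm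
  have ed : Fin (8 * k) ≃ (Fin a × Fin q) × Fin 8 :=
    (Fintype.equivFinOfCardEq (by simp [hk]; ring)).symm
  refine split_main (by omega) ⟨0, by positivity⟩ (split_kagome hq es ed)
    (ed.symm ((⟨0, ha⟩, ⟨0, hq0⟩), 2)) (vx (⟨0, ha⟩, ⟨0, hq0⟩) (2, 1)) ?_
  intro s
  simp only [Equiv.apply_symm_apply]
  congr 1
end
end

section
/- Let G be a finite simple graph and U ⊆ V(G) a set of vertices such that the induced subgraph G \ U is a forest. Then β̃(I(G)) ≤ |I(G[U])|, the number of independent sets of G[U] including the empty set. -/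
attribute [local instance] Classical.propDecidable

noncomputable section

open Finset Module
open scoped DirectSum

universe u

namespace SComplex

variable {V : Type u}

/-- The faces of the induced subcomplex `K[U]`; its cardinality (`Set.ncard`, counting
the empty face) is the quantity `|K[U]|`. -/
def facesIn (K : SComplex V) (U : Set V) : Set (Finset V) :=
  {s | s ∈ K.faces ∧ ∀ v ∈ s, v ∈ U}

/-- For a vertex partition `V = U ⊔ W` (`W = Uᶜ`) and a face `σ` of `K[U]`, the
subcomplex `lk_W σ` of `K[W]`: the faces `τ ⊆ W` with `τ ⊔ σ ∈ K`. -/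
def lkW (K : SComplex V) (U : Set V) (σ : Finset V) (hσ : σ ∈ K.faces) : SComplex V where
  faces := {τ | (∀ v ∈ τ, v ∉ U) ∧ τ ∪ σ ∈ K.faces}
  empty_mem := ⟨by simp, by simpa using hσ⟩
  down_closed := by
    rintro s t ⟨hs1, hs2⟩ hts
    exact ⟨fun v hv => hs1 v (hts hv),
      K.down_closed hs2 (Finset.union_subset_union hts le_rfl)⟩

/-- For a vertex partition `V = U ⊔ W` and a face `σ` of `K[U]`, the subcomplex
`st_W σ = (lk_W σ) ∗ σ` of `K`: the faces `τ ∈ K` with `τ ∩ U ⊆ σ` and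
`τ ∩ W ∈ lk_W σ`. -/
def stW (K : SComplex V) (U : Set V) (σ : Finset V) (hσ : σ ∈ K.faces) : SComplex V where
  faces := {τ | τ ∈ K.faces ∧ (∀ v ∈ τ, v ∈ U → v ∈ σ) ∧
    (τ.filter (fun v => v ∉ U)) ∪ σ ∈ K.faces}
  empty_mem := ⟨K.empty_mem, by simp, by simpa using hσ⟩
  down_closed := by
    rintro s t ⟨hs1, hs2, hs3⟩ hts
    refine ⟨K.down_closed hs1 hts, fun v hv hvU => hs2 v (hts hv) hvU,
      K.down_closed hs3 ?_⟩
    exact Finset.union_subset_union (Finset.filter_subset_filter _ hts) le_rfl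

end SComplex
namespace S16

/-- Ambient space of all formal combinations of lists of vertices. -/
abbrev A (V : Type) := List V →₀ ℚ

/-- Prepending a vertex. -/
def consL {V : Type} (x : V) : A V →ₗ[ℚ] A V := Finsupp.lmapDomain ℚ ℚ (List.cons x)

/-- Boundary of a list. -/
def dl {V : Type} : List V → A V
  | [] => 0
  | x :: l => Finsupp.single l 1 - consL x (dl l)

/-- Boundary. -/
def D {V : Type} : A V →ₗ[ℚ] A V := Finsupp.linearCombination ℚ dl

variable {V : Type}

lemma D_single (l : List V) : D (Finsupp.single l 1) = dl l := by
  simp [D]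

lemma consL_single (x : V) (l : List V) (c : ℚ) :
    consL x (Finsupp.single l c) = Finsupp.single (x :: l) c := by
  simp [consL]

lemma D_cons (x : V) (a : A V) : D (consL x a) = a - consL x (D a) := by
  have : D ∘ₗ consL x = LinearMap.id - consL x ∘ₗ D := by
    apply Finsupp.lhom_ext'
    intro l
    apply LinearMap.ext_ring
    simp [consL_single, D_single, dl]
  exact LinearMap.congr_fun this a

lemma D_dl (l : List V) : D (dl l) = 0 := by
  induction l with
  | nil => simp [dl]
  | cons x l ih => simp [dl, D_cons, D_single, ih]

lemma D_D (a : A V) : D (D a) = 0 := by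
  have : D ∘ₗ D = (0 : A V →ₗ[ℚ] A V) := by
    apply Finsupp.lhom_ext'
    intro l
    apply LinearMap.ext_ring
    simp [D_single, D_dl]
  exact LinearMap.congr_fun this a

/-- chains supported on `P` -/
abbrev C (P : Set (List V)) : Submodule ℚ (A V) := Finsupp.supported ℚ ℚ P

lemma consL_mem {P Q : Set (List V)} (x : V) (h : ∀ l ∈ P, x :: l ∈ Q) {a : A V}
    (ha : a ∈ C P) : consL x a ∈ C Q := by
  rw [Finsupp.mem_supported] at *
  intro l hl
  have := Finsupp.mapDomain_support hl
  simp only [Finset.mem_image] at this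
  obtain ⟨l', hl', rfl⟩ := this
  exact h _ (ha hl')

lemma dl_mem (l : List V) : dl l ∈ C {l' : List V | l' ⊆ l} := by
  induction l with
  | nil => simp [dl]
  | cons x l ih =>
    rw [dl]
    refine Submodule.sub_mem _ (Finsupp.single_mem_supported ℚ 1 ?_) (consL_mem x ?_ ih)
    · simp
    · intro l' hl'
      exact List.cons_subset_cons x hl'

/-- Closed under sub-lists (as sets). -/
def Cl (P : Set (List V)) : Prop := ∀ l ∈ P, ∀ l' : List V, l' ⊆ l → l' ∈ P

lemma D_mem {P : Set (List V)} (hP : Cl P) {a : A V} (ha : a ∈ C P) : D a ∈ C P := by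
  rw [D, Finsupp.linearCombination_apply]
  refine Submodule.sum_mem _ fun l hl => Submodule.smul_mem _ _ ?_
  exact Finsupp.supported_mono (fun l' hl' => hP l (ha hl) l' hl') (dl_mem l)

/-- The homology of the complex of `P` is spanned by `n` elements. -/
def Bd (P : Set (List V)) (n : ℕ) : Prop :=
  ∃ t : Finset (A V), t.card ≤ n ∧
    ∀ z ∈ C P, D z = 0 → z ∈ (C P).map D ⊔ Submodule.span ℚ (t : Set (A V))

lemma lift_lemma {E : Type} [AddCommGroup E] [Module ℚ E] (M B B' : Submodule ℚ E)
    (f : E →ₗ[ℚ] E) (t t' : Finset E)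
    (h : ∀ z ∈ M, f z ∈ B' ⊔ Submodule.span ℚ (t' : Set E))
    (h2 : ∀ z ∈ M, f z ∈ B' → z ∈ B ⊔ Submodule.span ℚ (t : Set E)) :
    ∃ s : Finset E, s.card ≤ t.card + t'.card ∧ ∀ z ∈ M, z ∈ B ⊔ Submodule.span ℚ (s : Set E) := by
  let g : M →ₗ[ℚ] E ⧸ B' := B'.mkQ ∘ₗ f ∘ₗ M.subtype
  have hr : LinearMap.range g ≤ Submodule.span ℚ ((t'.image B'.mkQ : Finset (E ⧸ B')) : Set (E ⧸ B')) := by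
    rintro _ ⟨⟨z, hz⟩, rfl⟩
    obtain ⟨b, hb, c, hc, hbc⟩ := Submodule.mem_sup.1 (h z hz)
    have : g ⟨z, hz⟩ = B'.mkQ c := by
      simp only [g, LinearMap.comp_apply, Submodule.subtype_apply, ← hbc, map_add]
      simp [hb]
    rw [this, Finset.coe_image, ← Submodule.map_span]
    exact Submodule.mem_map_of_mem hc
  have : FiniteDimensional ℚ (LinearMap.range g) := Submodule.finiteDimensional_of_le hr
  have hcard : finrank ℚ (LinearMap.range g) ≤ t'.card :=
    (Submodule.finrank_mono hr).trans ((finrank_span_finset_le_card _).trans Finset.card_image_le)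
  let b := Module.finBasis ℚ (LinearMap.range g)
  have hl : ∀ i, ∃ y : M, g y = b i := fun i => (b i).2
  choose y hy using hl
  refine ⟨t ∪ Finset.univ.image (fun i => (y i : E)), ?_, ?_⟩
  · refine (Finset.card_union_le _ _).trans (Nat.add_le_add_left ?_ _)
    refine Finset.card_image_le.trans ?_
    simpa using hcard
  · intro z hz
    let w : M := ∑ i, b.repr ⟨g ⟨z, hz⟩, ⟨_, rfl⟩⟩ i • y i
    have hw : g w = g ⟨z, hz⟩ := by
      have h1 := congrArg Subtype.val (b.sum_repr ⟨g ⟨z, hz⟩, ⟨_, rfl⟩⟩)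
      simp only [w, map_sum, map_smul, hy]
      rw [Submodule.coe_sum] at h1
      exact h1
    have hd : f (z - w) ∈ B' := by
      rw [← Submodule.Quotient.mk_eq_zero, ← Submodule.mkQ_apply]
      have : g (⟨z, hz⟩ - w) = 0 := by rw [map_sub, hw, sub_self]
      exact this
    have h3 := h2 (z - w) (M.sub_mem hz w.2) hd
    have h4 : (w : E) ∈ Submodule.span ℚ ((Finset.univ.image (fun i => (y i : E)) : Finset E) : Set E) := by
      simp only [w, Submodule.coe_sum, Submodule.coe_smul]
      refine Submodule.sum_mem _ fun i _ => Submodule.smul_mem _ _ (Submodule.subset_span ?_)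
      simp
    rw [Finset.coe_union, Submodule.span_union, ← sup_assoc]
    have := Submodule.add_mem_sup h3 h4
    simpa using this

lemma Bd_MV {P : Set (List V)} (hP : Cl P) (v : V) {m n : ℕ}
    (hL : Bd {l | l ∈ P ∧ v ∉ l} m) (hQ : Bd {l | v :: l ∈ P ∧ v ∉ l} n) : Bd P (m + n) := by
  obtain ⟨t, ht, hL⟩ := hL
  obtain ⟨t', ht', hQ⟩ := hQ
  set L : Set (List V) := {l | l ∈ P ∧ v ∉ l} with hLdef
  set Q : Set (List V) := {l | v :: l ∈ P ∧ v ∉ l} with hQdef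
  set St : Set (List V) := {l | v :: l ∈ P} with hStdef
  have cSt : Cl St := fun l hl l' hl' => hP _ hl _ (List.cons_subset_cons v hl')
  have cL : Cl L := fun l hl l' hl' => ⟨hP _ hl.1 _ hl', fun h => hl.2 (hl' h)⟩
  have StP : St ⊆ P := fun l hl => hP _ hl _ (by simp)
  have LP : L ⊆ P := fun l hl => hl.1
  have QL : Q ⊆ L := fun l hl => ⟨StP hl.1, hl.2⟩
  have QSt : Q ⊆ St := fun l hl => hl.1
  let p : A V →ₗ[ℚ] A V :=
    { toFun := fun a => a.filter (fun l => v ∉ l)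
      map_add' := fun a b => Finsupp.filter_add
      map_smul' := fun c a => Finsupp.filter_smul }
  have hpL : ∀ z ∈ C P, p z ∈ C L := by
    intro z hz
    rw [Finsupp.mem_supported] at *
    intro l hl
    have : l ∈ (z.filter (fun l => v ∉ l)).support := hl
    rw [Finsupp.support_filter, Finset.mem_filter] at this
    exact ⟨hz this.1, this.2⟩
  have hpS : ∀ z ∈ C P, z - p z ∈ C St := by
    intro z hz
    have : z - p z = z.filter (fun l => ¬ v ∉ l) := by
      rw [sub_eq_iff_eq_add, add_comm]
      exact (Finsupp.filter_add_filter_not z _).symm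
    rw [this]
    rw [Finsupp.mem_supported] at *
    intro l hl
    rw [Finset.mem_coe, Finsupp.support_filter, Finset.mem_filter] at hl
    have hv : v ∈ l := not_not.1 hl.2
    exact hP _ (hz hl.1) _ (by simp [hv])
  have key := lift_lemma (C P ⊓ LinearMap.ker D) ((C P).map D) ((C Q).map D) (D ∘ₗ p) t t' ?_ ?_
  · obtain ⟨s, hs, h⟩ := key
    exact ⟨s, by omega, fun z hz hz' => h z ⟨hz, hz'⟩⟩
  · rintro z ⟨hz, hz'⟩
    have hz' : D z = 0 := hz'
    refine hQ _ ?_ (D_D _)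
    have h1 : D (p z) ∈ C L := D_mem cL (hpL z hz)
    have h2 : D (p z) ∈ C St := by
      have := D_mem cSt (hpS z hz)
      rw [map_sub, hz', zero_sub] at this
      simpa using this
    have h3 : D (p z) ∈ C L ⊓ C St := ⟨h1, h2⟩
    rw [← Finsupp.supported_inter] at h3
    have h5 : L ∩ St ⊆ Q := fun l hl => ⟨hl.2, hl.1.2⟩
    exact Finsupp.supported_mono h5 h3
  · rintro z ⟨hz, hz'⟩ ⟨c, hc, hcz⟩
    have hz' : D z = 0 := hz'
    have hcz : D c = D (p z) := hcz
    have h1 := hL (p z - c) (Submodule.sub_mem _ (hpL z hz) (Finsupp.supported_mono QL hc))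
      (by rw [map_sub, hcz, sub_self])
    have h2 : z - p z + c ∈ C St :=
      Submodule.add_mem _ (hpS z hz) (Finsupp.supported_mono QSt hc)
    have h3 : z - p z + c ∈ (C P).map D := by
      refine ⟨consL v (z - p z + c), consL_mem v (fun l hl => hl) h2, ?_⟩
      rw [D_cons]
      have : D (z - p z + c) = 0 := by rw [map_add, map_sub, hz', hcz]; simp
      simp [this]
    have h4 : p z - c ∈ (C P).map D ⊔ Submodule.span ℚ (t : Set (A V)) :=
      (sup_le_sup_right (Submodule.map_mono (Finsupp.supported_mono LP)) _ :
        (C L).map D ⊔ Submodule.span ℚ (t : Set (A V)) ≤ _) h1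
    have := Submodule.add_mem _ h4 (Submodule.mem_sup_left h3)
    convert this using 1
    abel

lemma Bd_cone {P : Set (List V)} (v : V) (h : ∀ l ∈ P, v :: l ∈ P) : Bd P 0 := by
  refine ⟨∅, le_rfl, fun z hz hz' => Submodule.mem_sup_left ⟨consL v z, consL_mem v h hz, ?_⟩⟩
  rw [D_cons, hz']; simp

lemma Bd_nil {P : Set (List V)} (h : ∀ l ∈ P, l = []) : Bd P 1 := by
  refine ⟨{Finsupp.single [] 1}, by simp, fun z hz _ => Submodule.mem_sup_right ?_⟩
  have : z = z [] • Finsupp.single [] 1 := by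
    ext l
    by_cases hl : l = []
    · subst hl; simp
    · have : z l = 0 := by
        by_contra h0
        exact hl (h l (hz (by simpa using h0)))
      simp [this, Ne.symm hl]
  rw [this]
  exact Submodule.smul_mem _ _ (Submodule.subset_span (by simp))

section Bridge
open SComplex

variable (K : SComplex V)

/-- list of an ordered simplex -/
def lst (j : ℕ) (s : OSimplex K j) : List V := List.ofFn s.1

lemma lst_inj (j : ℕ) : Function.Injective (lst K j) := fun _ _ h =>
  Subtype.ext (List.ofFn_injective h)

/-- inclusion of graded chains -/
def inc (j : ℕ) : Chain K j →ₗ[ℚ] A V := Finsupp.lmapDomain ℚ ℚ (lst K j)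

/-- graded component -/
def ret (j : ℕ) : A V →ₗ[ℚ] Chain K j := Finsupp.lcomapDomain (lst K j) (lst_inj K j)

/-- lists of the complex -/
def PK : Set (List V) := {l | l.toFinset ∈ K.faces}

lemma image_ofFn {j : ℕ} (s : Fin j → V) : (List.ofFn s).toFinset = Finset.univ.image s := by
  ext x; simp [List.mem_ofFn]

lemma inc_single (j : ℕ) (s : OSimplex K j) (c : ℚ) :
    inc K j (Finsupp.single s c) = Finsupp.single (List.ofFn s.1) c :=
  Finsupp.mapDomain_single

lemma inc_mem (j : ℕ) (c : Chain K j) : inc K j c ∈ C (PK K) := by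
  rw [Finsupp.mem_supported]
  intro l hl
  have := Finsupp.mapDomain_support hl
  simp only [Finset.mem_image] at this
  obtain ⟨s, -, rfl⟩ := this
  show (List.ofFn s.1).toFinset ∈ K.faces
  rw [image_ofFn]
  exact s.2

lemma ret_inc (j : ℕ) (c : Chain K j) : ret K j (inc K j c) = c :=
  Finsupp.leftInverse_lcomapDomain_mapDomain (R := ℚ) _ (lst_inj K j) c

lemma ret_inc_ne {i j : ℕ} (h : i ≠ j) (c : Chain K i) : ret K j (inc K i c) = 0 := by
  ext s
  show (Finsupp.mapDomain (lst K i) c) (lst K j s) = 0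
  apply Finsupp.mapDomain_of_notMem_range
  rintro ⟨s', hs'⟩
  apply h
  have := congrArg List.length hs'
  simpa [lst] using this

lemma dl_ofFn (j : ℕ) (s : Fin (j + 1) → V) :
    dl (List.ofFn s) = ∑ i : Fin (j + 1),
      Finsupp.single (List.ofFn (s ∘ i.succAbove)) ((-1 : ℚ) ^ (i : ℕ)) := by
  induction j with
  | zero => simp [dl]
  | succ j ih =>
    rw [List.ofFn_succ, dl, ih (fun i => s i.succ), map_sum,
      Fin.sum_univ_succ (n := j + 1), sub_eq_add_neg,
      ← Finset.sum_neg_distrib]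
    congr 1
    refine Finset.sum_congr rfl fun i _ => ?_
    rw [consL_single, ← Finsupp.single_neg]
    congr 1
    · rw [List.ofFn_succ]
      simp [Function.comp_def]
    · simp [pow_succ]

lemma D_inc (j : ℕ) (c : Chain K (j + 1)) : D (inc K (j + 1) c) = inc K j (bdry K j c) := by
  have : D ∘ₗ inc K (j + 1) = inc K j ∘ₗ bdry K j := by
    apply Finsupp.lhom_ext'
    intro s
    apply LinearMap.ext_ring
    simp only [LinearMap.comp_apply, Finsupp.lsingle_apply]
    have h1 : inc K (j + 1) (Finsupp.single s 1) = Finsupp.single (List.ofFn s.1) 1 := by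
      simp [inc, lst]
    rw [h1, D_single, dl_ofFn]
    have h2 : bdry K j (Finsupp.single s 1) = bdryO K j s := by simp [bdry]
    rw [h2, bdryO, map_sum]
    refine Finset.sum_congr rfl fun i _ => ?_
    exact (inc_single K j ⟨s.1 ∘ i.succAbove, K.down_closed s.2 (by
      intro v hv
      simp only [Finset.mem_image] at hv ⊢
      obtain ⟨w, -, rfl⟩ := hv
      exact ⟨i.succAbove w, Finset.mem_univ _, rfl⟩)⟩ ((-1 : ℚ) ^ (i : ℕ))).symm
  exact LinearMap.congr_fun this c

lemma D_inc_zero (c : Chain K 0) : D (inc K 0 c) = 0 := by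
  have : D ∘ₗ inc K 0 = 0 := by
    apply Finsupp.lhom_ext'
    intro s
    apply LinearMap.ext_ring
    simp only [LinearMap.comp_apply, Finsupp.lsingle_apply]
    have h1 : inc K 0 (Finsupp.single s 1) = Finsupp.single (List.ofFn s.1) 1 := by
      simp [inc, lst]
    rw [h1, D_single]
    simp [dl]
  exact LinearMap.congr_fun this c

lemma ret_D (j : ℕ) {a : A V} (ha : a ∈ C (PK K)) :
    ret K j (D a) = bdry K j (ret K (j + 1) a) := by
  rw [C, Finsupp.supported_eq_span_single] at ha
  induction ha using Submodule.span_induction with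
  | mem x hx =>
    obtain ⟨l, hl, rfl⟩ := hx
    obtain ⟨i, s, rfl⟩ : ∃ (i : ℕ) (s : Fin i → V), l = List.ofFn s :=
      ⟨l.length, l.get, (List.ofFn_get l).symm⟩
    have hs : Finset.univ.image s ∈ K.faces := by rw [← image_ofFn]; exact hl
    have h1 : (Finsupp.single (List.ofFn s) 1 : A V) =
        inc K i (Finsupp.single (⟨s, hs⟩ : OSimplex K i) 1) :=
      (inc_single K i ⟨s, hs⟩ 1).symm
    beta_reduce
    rw [h1]
    by_cases hij : i = j + 1
    · subst hij
      rw [D_inc, ret_inc, ret_inc]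
    · rw [ret_inc_ne K hij, map_zero]
      cases i with
      | zero => rw [D_inc_zero, map_zero]
      | succ i => rw [D_inc, ret_inc_ne K (by omega)]
  | zero => simp
  | add x y _ _ hx hy => simp [hx, hy]
  | smul c x _ hx => simp [hx]

/-- total boundaries -/
def BK : Submodule ℚ (A V) := (C (PK K)).map D

lemma D_inc_cycle (j : ℕ) (c : Chain K j) (hc : c ∈ cyclesAt K j) : D (inc K j c) = 0 := by
  cases j with
  | zero => exact D_inc_zero K c
  | succ j =>
    have : bdry K j c = 0 := hc
    rw [D_inc, this, map_zero]

/-- homology in the ambient quotient -/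
def phi (j : ℕ) : homologyAt K j →ₗ[ℚ] A V ⧸ BK K :=
  Submodule.liftQ _ ((BK K).mkQ ∘ₗ inc K j ∘ₗ (cyclesAt K j).subtype) (by
    rintro ⟨z, hz⟩ ⟨x, hx⟩
    have hx : bdry K j x = z := hx
    simp only [LinearMap.mem_ker, LinearMap.comp_apply, Submodule.subtype_apply,
      Submodule.mkQ_apply, Submodule.Quotient.mk_eq_zero]
    rw [← hx, ← D_inc]
    exact ⟨_, inc_mem K _ _, rfl⟩)

/-- components -/
def theta (j : ℕ) : (A V ⧸ BK K) →ₗ[ℚ] Chain K j ⧸ boundariesAt K j :=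
  Submodule.liftQ _ ((boundariesAt K j).mkQ ∘ₗ ret K j) (by
    rintro _ ⟨a, ha, rfl⟩
    simp only [LinearMap.mem_ker, LinearMap.comp_apply,
      Submodule.mkQ_apply, Submodule.Quotient.mk_eq_zero]
    rw [ret_D K j ha]
    exact ⟨_, rfl⟩)

lemma theta_phi_ne {i j : ℕ} (h : i ≠ j) (x : homologyAt K i) : theta K j (phi K i x) = 0 := by
  obtain ⟨⟨z, hz⟩, rfl⟩ := Submodule.Quotient.mk_surjective _ x
  show (boundariesAt K j).mkQ (ret K j (inc K i z)) = 0
  rw [ret_inc_ne K h, map_zero]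

lemma theta_phi_inj (j : ℕ) (x : homologyAt K j) (h : theta K j (phi K j x) = 0) : x = 0 := by
  obtain ⟨⟨z, hz⟩, rfl⟩ := Submodule.Quotient.mk_surjective _ x
  have h : (boundariesAt K j).mkQ (ret K j (inc K j z)) = 0 := h
  rw [ret_inc, Submodule.mkQ_apply, Submodule.Quotient.mk_eq_zero] at h
  rw [Submodule.Quotient.mk_eq_zero]
  exact h

theorem totalBetti_le {n : ℕ} (h : Bd (PK K) n) : totalBetti K ≤ n := by
  obtain ⟨t, ht, h⟩ := h
  let Φ : (⨁ j : ℕ, homologyAt K j) →ₗ[ℚ] A V ⧸ BK K := DirectSum.toModule ℚ ℕ _ (phi K)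
  have hθ : ∀ (j : ℕ) (x : ⨁ j : ℕ, homologyAt K j), theta K j (Φ x) = theta K j (phi K j (x j)) := by
    intro j x
    induction x using DirectSum.induction_on with
    | zero => simp
    | of i x =>
      have h1 : Φ (DirectSum.of (fun j => homologyAt K j) i x) = phi K i x :=
        DirectSum.toModule_lof ℚ i x
      rw [h1]
      by_cases hij : i = j
      · subst hij
        rw [DirectSum.of_eq_same]
      · rw [theta_phi_ne K hij, DirectSum.of_eq_of_ne _ _ _ (Ne.symm hij), map_zero, map_zero]
    | add x y hx hy => rw [map_add, map_add, hx, hy, DirectSum.add_apply, map_add, map_add]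
  have hinj : Function.Injective Φ := by
    intro x y hx
    apply DFinsupp.ext
    intro j
    refine sub_eq_zero.1 (theta_phi_inj K j (x j - y j) ?_)
    rw [map_sub, map_sub, ← hθ, ← hθ, hx, sub_self]
  have hr : ∀ x, Φ x ∈ Submodule.span ℚ ((t.image (BK K).mkQ : Finset _) : Set (A V ⧸ BK K)) := by
    intro x
    induction x using DirectSum.induction_on with
    | zero => simp
    | of i x =>
      have h1 : Φ (DirectSum.of (fun j => homologyAt K j) i x) = phi K i x :=
        DirectSum.toModule_lof ℚ i x
      rw [h1]
      obtain ⟨⟨z, hz⟩, rfl⟩ := Submodule.Quotient.mk_surjective _ x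
      show (BK K).mkQ (inc K i z) ∈ _
      obtain ⟨b, hb, c, hc, hbc⟩ :=
        Submodule.mem_sup.1 (h (inc K i z) (inc_mem K i z) (D_inc_cycle K i z hz))
      have h2 : (BK K).mkQ b = 0 := by
        rw [Submodule.mkQ_apply, Submodule.Quotient.mk_eq_zero]; exact hb
      rw [← hbc, map_add, h2, zero_add, Finset.coe_image, ← Submodule.map_span]
      exact Submodule.mem_map_of_mem hc
    | add x y hx hy => rw [map_add]; exact Submodule.add_mem _ hx hy
  let Ψ := Φ.codRestrict _ hr
  have hΨ : Function.Injective Ψ := fun x y hxy => hinj (congrArg Subtype.val hxy)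
  refine (LinearMap.finrank_le_finrank_of_injective hΨ).trans ?_
  exact (finrank_span_finset_le_card _).trans (Finset.card_image_le.trans ht)

end Bridge

section Graph

variable (G : SimpleGraph V)

/-- lists of independent vertices in `S` -/
def IL (S : Finset V) : Set (List V) := {l | ∀ v ∈ l, v ∈ S ∧ ∀ w ∈ l, ¬ G.Adj v w}

lemma IL_cl (S : Finset V) : Cl (IL G S) := fun _ hl _ hl' v hv =>
  ⟨(hl v (hl' hv)).1, fun w hw => (hl v (hl' hv)).2 w (hl' hw)⟩

/-- Remove the closed neighbourhood of `v`. -/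
def rm (S : Finset V) (v : V) : Finset V := S.filter (fun w => w ≠ v ∧ ¬ G.Adj v w)

lemma Bd_step (S : Finset V) (v : V) (hv : v ∈ S) {m n : ℕ}
    (h1 : Bd (IL G (S.erase v)) m) (h2 : Bd (IL G (rm G S v)) n) : Bd (IL G S) (m + n) := by
  apply Bd_MV (IL_cl G S) v
  · convert h1 using 1
    ext l
    simp only [IL, Set.mem_ofPred_eq, Finset.mem_erase]
    grind
  · convert h2 using 1
    ext l
    simp only [IL, rm, Set.mem_ofPred_eq, Finset.mem_filter, List.mem_cons]
    have := G.symm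
    have h3 : ∀ a b, G.Adj a b → G.Adj b a := fun a b h => h.symm
    have h4 : ∀ a, ¬ G.Adj a a := fun a => G.irrefl
    constructor
    · rintro ⟨h, hvl⟩ w hw
      refine ⟨⟨(h w (Or.inr hw)).1, fun e => hvl (e ▸ hw), (h v (Or.inl rfl)).2 w (Or.inr hw)⟩,
        fun u hu => (h w (Or.inr hw)).2 u (Or.inr hu)⟩
    · intro h
      refine ⟨?_, fun hvl => (h v hvl).1.2.1 rfl⟩
      rintro w (rfl | hw)
      · refine ⟨hv, ?_⟩
        rintro u (rfl | hu)
        · exact h4 u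
        · exact (h u hu).1.2.2
      · refine ⟨(h w hw).1.1, ?_⟩
        rintro u (rfl | hu)
        · exact fun e => (h w hw).1.2.2 (h3 _ _ e)
        · exact (h w hw).2 u hu

lemma Bd_isolated (S : Finset V) (v : V) (hv : v ∈ S) (h : ∀ w ∈ S, ¬ G.Adj v w) :
    Bd (IL G S) 0 := by
  apply Bd_cone v
  intro l hl u hu
  rw [List.mem_cons] at hu
  have h3 : ∀ a b, G.Adj a b → G.Adj b a := fun a b h => h.symm
  have h4 : ∀ a, ¬ G.Adj a a := fun a => G.irrefl
  rcases hu with rfl | hu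
  · refine ⟨hv, fun w hw => ?_⟩
    rcases List.mem_cons.1 hw with rfl | hw
    · exact h4 w
    · exact h w (hl w hw).1
  · refine ⟨(hl u hu).1, fun w hw => ?_⟩
    rcases List.mem_cons.1 hw with rfl | hw
    · exact fun e => h u (hl u hu).1 (h3 _ _ e)
    · exact (hl u hu).2 w hw

lemma exists_leaf {W : Type} [Finite W] [Nonempty W] (H : SimpleGraph W) (h : H.IsAcyclic) :
    ∃ u x : W, ∀ w, H.Adj u w → w = x := by
  have := Fintype.ofFinite W
  let p : ℕ → Prop := fun n => ∃ (u v : W) (q : H.Walk u v), q.IsPath ∧ q.length = n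
  have hb : ∀ n, p n → n ≤ Fintype.card W := by
    rintro n ⟨u, v, q, hq, rfl⟩
    exact hq.length_lt.le
  obtain ⟨a⟩ := ‹Nonempty W›
  have h0 : p 0 := ⟨a, a, SimpleGraph.Walk.nil, by simp, rfl⟩
  obtain ⟨u, v, q, hq, hl⟩ := Nat.findGreatest_spec (P := p) (Nat.zero_le (Fintype.card W)) h0
  refine ⟨u, q.snd, fun w hw => ?_⟩
  by_cases hs : w ∈ q.support
  · exact h.eq_snd_of_adj_start hq hw hs
  · exfalso
    have hp : p (q.length + 1) :=
      ⟨w, v, SimpleGraph.Walk.cons hw.symm q, by simp [SimpleGraph.Walk.cons_isPath_iff, hq, hs], by simp⟩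
    have := Nat.le_findGreatest (hb _ hp) hp
    omega

lemma acyclic_mono {S T : Finset V} (hST : S ⊆ T) (h : (G.induce (T : Set V)).IsAcyclic) :
    (G.induce (S : Set V)).IsAcyclic :=
  h.embedding (SimpleGraph.induceHomOfLE G (by exact_mod_cast hST))

lemma Bd_forest (S : Finset V) (h : (G.induce (S : Set V)).IsAcyclic) : Bd (IL G S) 1 := by
  induction S using Finset.strongInduction with
  | H S ih =>
    by_cases hS : S.Nonempty
    · have : Nonempty (S : Set V) := hS.coe_sort
      obtain ⟨⟨u, hu⟩, ⟨x, hx⟩, hux⟩ := exists_leaf _ h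
      have hux' : ∀ w ∈ S, G.Adj u w → w = x := fun w hw hadj =>
        congrArg Subtype.val (hux ⟨w, hw⟩ hadj)
      have hu : u ∈ S := hu
      have hx : x ∈ S := hx
      by_cases hadj : G.Adj u x
      · have hs : rm G S x ⊂ S := by
          refine (Finset.ssubset_iff_of_subset (Finset.filter_subset _ _)).2 ⟨x, hx, by simp [rm]⟩
        have h1 := ih _ hs (acyclic_mono G hs.1 h)
        have h2 : Bd (IL G (S.erase x)) 0 := by
          apply Bd_isolated G _ u (by simp [hu, hadj.ne])
          intro w hw ha
          rw [Finset.mem_erase] at hw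
          exact hw.1 (hux' w hw.2 ha)
        simpa using Bd_step G S x hx h2 h1
      · obtain ⟨t, ht, h'⟩ := Bd_isolated G S u hu
          (fun w hw ha => hadj (by rw [← hux' w hw ha]; exact ha))
        exact ⟨t, by omega, h'⟩
    · rw [Finset.not_nonempty_iff_eq_empty] at hS
      subst hS
      apply Bd_nil
      intro l hl
      rw [List.eq_nil_iff_forall_not_mem]
      intro v hv
      simpa using (hl v hv).1

/-- independent subsets of `T` -/
def ind (T : Finset V) : Finset (Finset V) :=
  T.powerset.filter (fun s => ∀ v ∈ s, ∀ w ∈ s, ¬ G.Adj v w)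

lemma ind_card (T : Finset V) (v : V) (hv : v ∈ T) :
    (ind G T).card = (ind G (T.erase v)).card + (ind G (rm G T v)).card := by
  have h3 : ∀ a b, G.Adj a b → G.Adj b a := fun a b h => h.symm
  have h4 : ∀ a, ¬ G.Adj a a := fun a => G.irrefl
  have e1 : ind G (T.erase v) = (ind G T).filter (fun s => v ∉ s) := by
    ext s
    simp only [ind, Finset.mem_filter, Finset.mem_powerset, Finset.subset_erase]
    tauto
  have e2 : (ind G (rm G T v)).card = ((ind G T).filter (fun s => ¬ v ∉ s)).card := by
    refine Finset.card_bij (fun s _ => insert v s) ?_ ?_ ?_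
    · intro s hs
      simp only [ind, rm, Finset.mem_filter, Finset.mem_powerset, Finset.subset_iff] at hs ⊢
      simp only [Finset.mem_insert]
      grind
    · intro s hs s' hs' e
      simp only [ind, rm, Finset.mem_filter, Finset.mem_powerset, Finset.subset_iff] at hs hs'
      have a1 : v ∉ s := fun h => (hs.1 h).2.1 rfl
      have a2 : v ∉ s' := fun h => (hs'.1 h).2.1 rfl
      rw [← Finset.erase_insert a1, ← Finset.erase_insert a2]
      exact congrArg (fun t => Finset.erase t v) e
    · intro s hs
      simp only [ind, Finset.mem_filter, Finset.mem_powerset, Finset.subset_iff, not_not] at hs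
      refine ⟨s.erase v, ?_, Finset.insert_erase hs.2⟩
      simp only [ind, rm, Finset.mem_filter, Finset.mem_powerset, Finset.subset_iff, Finset.mem_erase]
      grind
  rw [e1, e2, Finset.card_filter_add_card_filter_not]

lemma Bd_main (T : Finset V) : ∀ W : Finset V, Disjoint T W →
    (G.induce (W : Set V)).IsAcyclic → Bd (IL G (T ∪ W)) (ind G T).card := by
  induction T using Finset.strongInduction with
  | H T ih =>
    intro W hd hW
    by_cases hT : T.Nonempty
    · obtain ⟨v, hv⟩ := hT
      have hvW : v ∉ W := Finset.disjoint_left.1 hd hv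
      rw [ind_card G T v hv]
      apply Bd_step G _ v (by simp [hv])
      · have e : (T ∪ W).erase v = T.erase v ∪ W := by
          rw [Finset.erase_union_distrib, Finset.erase_eq_of_notMem hvW]
        rw [e]
        exact ih _ (Finset.erase_ssubset hv) W (hd.mono_left (Finset.erase_subset _ _)) hW
      · have e : rm G (T ∪ W) v = rm G T v ∪ rm G W v := Finset.filter_union _ _ _
        rw [e]
        refine ih _ ?_ _ (hd.mono (Finset.filter_subset _ _) (Finset.filter_subset _ _))
          (acyclic_mono G (Finset.filter_subset _ _) hW)
        exact (Finset.ssubset_iff_of_subset (Finset.filter_subset _ _)).2 ⟨v, hv, by simp [rm]⟩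
    · rw [Finset.not_nonempty_iff_eq_empty] at hT
      subst hT
      have : (ind G ∅).card = 1 := by
        rw [ind, Finset.powerset_empty, Finset.filter_singleton]
        simp
      rw [this, Finset.empty_union]
      exact Bd_forest G W hW

end Graph

end S16

/-- Let `G` be a finite simple graph and `U ⊆ V(G)` such that the induced
subgraph `G \ U = G[Uᶜ]` is a forest (acyclic).  Then `β̃(I(G)) ≤ |I(G[U])|`, the number
of independent sets of `G[U]`, the empty one included. -/
theorem statement16 {V : Type} [Fintype V] (G : SimpleGraph V) (U : Set V)
    (h : (G.induce Uᶜ).IsAcyclic) :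
    SComplex.totalBetti (indepComplex G) ≤
      (SComplex.facesIn (indepComplex G) U).ncard := by
  have h1 := S16.Bd_main G U.toFinset (Uᶜ).toFinset
    (by rw [Set.disjoint_toFinset]; exact disjoint_compl_right) (by rw [Set.coe_toFinset]; exact h)
  have e1 : S16.IL G (U.toFinset ∪ (Uᶜ).toFinset) = S16.PK (indepComplex G) := by
    ext l
    simp only [S16.IL, S16.PK, indepComplex, Set.mem_ofPred_eq, Finset.mem_union, Set.mem_toFinset,
      List.mem_toFinset, Set.mem_compl_iff]
    exact ⟨fun H v hv => (H v hv).2, fun H v hv => ⟨em _, H v hv⟩⟩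
  have e2 : SComplex.facesIn (indepComplex G) U = (S16.ind G U.toFinset : Set (Finset V)) := by
    ext s
    simp only [SComplex.facesIn, indepComplex, S16.ind, Set.mem_ofPred_eq, Finset.coe_filter,
      Finset.mem_powerset, Finset.subset_iff, Set.mem_toFinset]
    exact and_comm
  rw [e1] at h1
  rw [e2, Set.ncard_coe_finset]
  exact S16.totalBetti_le _ h1
end
end
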